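/- arXiv:2601.08771 — 3 statements merged into one kernel-verified Lean document; each statement's English description precedes it below -/
import Mathlib

section
/- Let g : ℝ → ℝ be locally Lipschitz and h ∈ C²(ℝ) with h(0) = h'(0) = 0 and h' strictly increasing. Let a < b be real numbers with g(a) = g(b) = 0 and g(x) > 0 for all x ∈ (a,b), and let T > 0. Let u, v ∈ L¹_loc((a,b) × (0,T)) be measurable functions such that (x,t) ↦ g(x)h(u(x,t)) and (x,t) ↦ g(x)h(v(x,t)) are essentially bounded on (a,b) × (0,T), and suppose both u and v satisfy the interior Kružkov entropy inequality on (a,b) × (0,T): for every k ∈ ℝ and every nonnegative φ ∈ C_c^∞ with support contained in (a,b) × (0,T), ∬ [ |w − k| ∂_tφ + sgn(w − k)(g(x)h(w) − g(x)h(k)) ∂_xφ − sgn(w − k)·g'(x)·h(k)·φ ] dx dt ≥ 0 for w = u and w = v (g' the a.e. derivative of g). Assume further the interface condition: for a.e. t ∈ (0,T) there exist δ > 0 and R > 0 such that u(x,t) ≤ R and v(x,t) ≤ R for a.e. x ∈ (a, a+δ), and u(x,t) ≥ −R and v(x,t) ≥ −R for a.e. x ∈ (b−δ, b). Then for a.e.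 σ, τ ∈ (0,T) with σ < τ: ∫_a^b |u(x,τ) − v(x,τ)| dx ≤ ∫_a^b |u(x,σ) − v(x,σ)| dx (as integrals with values in [0,∞]). -/
open MeasureTheory Set Filter

/-- The sign function: `1` for `s ≥ 0`, `−1` for `s < 0`. -/
noncomputable def sgn (s : ℝ) : ℝ := if 0 ≤ s then 1 else -1

/-- `w` satisfies the interior Kružkov entropy inequality on `(a,b) × (0,T)` for the
multiplicative flux `f(x,v) = g(x)h(v)`: for every constant `k` and every nonnegative
smooth compactly supported test function with support in `(a,b) × (0,T)`. -/
def InteriorEntropy (g h : ℝ → ℝ) (a b T : ℝ) (w : ℝ × ℝ → ℝ) : Prop :=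
  ∀ (k : ℝ) (φ : ℝ × ℝ → ℝ), ContDiff ℝ (⊤ : ℕ∞) φ → HasCompactSupport φ →
    (∀ p, 0 ≤ φ p) → tsupport φ ⊆ Ioo a b ×ˢ Ioo 0 T →
    0 ≤ ∫ t in Ioo (0 : ℝ) T, ∫ x in Ioo a b,
        (|w (x, t) - k| * fderiv ℝ φ (x, t) (0, 1)
          + sgn (w (x, t) - k) * (g x * h (w (x, t)) - g x * h k)
              * fderiv ℝ φ (x, t) (1, 0)
          - sgn (w (x, t) - k) * deriv g x * h k * φ (x, t))


section partOne
open Topology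

/-- bounded + measurable + bounded support is integrable -/
lemma integrable_of_bdd_supp {E : Type*} [MeasurableSpace E] {μ : Measure E}
    {f : E → ℝ} (hf : AEStronglyMeasurable f μ) {K : Set E} (hK : μ K < ⊤)
    (B : ℝ) (hB : ∀ p, |f p| ≤ B) (hs : ∀ p, p ∉ K → f p = 0) : Integrable f μ := by
  have h1 : IntegrableOn f K μ :=
    Measure.integrableOn_of_bounded (M := B) hK.ne hf (by
      filter_upwards with x; simpa using hB x)
  rw [← integrableOn_iff_integrable_of_support_subset (s := K)]
  · exact h1
  · intro p hp
    by_contra h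
    exact hp (hs p h)

lemma trans_cont_integrable (f : ℝ × ℝ → ℝ) (hf : Integrable f) (η : ℝ) (hη : 0 < η) :
    ∃ ε > 0, ∀ r : ℝ × ℝ, ‖r‖ < ε → ∫ p, |f (p - r) - f p| ≤ η := by
  obtain ⟨g, hgc, hfg, hg, hgi⟩ :=
    hf.exists_hasCompactSupport_integral_sub_le (ε := η / 4) (by positivity)
  have key : Tendsto (fun r : ℝ × ℝ => ∫ p, |g (p - r) - g p|) (𝓝 0) (𝓝 0) := by
    obtain ⟨B, hB⟩ := hg.bounded_above_of_compact_support hgc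
    obtain ⟨R, hR⟩ := hgc.isBounded.subset_closedBall (0 : ℝ × ℝ)
    have hz : ∀ p : ℝ × ℝ, R < ‖p‖ → g p = 0 := by
      intro p hp
      by_contra h
      have := hR (subset_tsupport _ h)
      simp at this
      exact absurd this (not_le.2 hp)
    have : Tendsto (fun r : ℝ × ℝ => ∫ p, |g (p - r) - g p|) (𝓝 0)
        (𝓝 (∫ p : ℝ × ℝ, (0 : ℝ))) := by
      apply tendsto_integral_filter_of_dominated_convergence
        (bound := (Metric.closedBall (0 : ℝ × ℝ) (R + 1)).indicator (fun _ => 2 * B))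
      · filter_upwards with r
        exact Continuous.aestronglyMeasurable (by fun_prop)
      · have : ∀ᶠ r : ℝ × ℝ in 𝓝 0, ‖r‖ < 1 := by
          have := Metric.ball_mem_nhds (0 : ℝ × ℝ) one_pos
          filter_upwards [this] with r hr
          simpa using hr
        filter_upwards [this] with r hr
        filter_upwards with p
        by_cases hp : p ∈ Metric.closedBall (0 : ℝ × ℝ) (R + 1)
        · rw [indicator_of_mem hp]
          have h1 := hB (p - r)
          have h2 := hB p
          rw [Real.norm_eq_abs] at *
          rw [abs_abs]
          have h1' := abs_le.1 h1
          have h2' := abs_le.1 h2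
          exact abs_le.2 ⟨by linarith, by linarith⟩
        · rw [indicator_of_notMem hp]
          simp at hp
          have h1 : g p = 0 := hz p (by linarith)
          have h2 : g (p - r) = 0 := by
            apply hz
            have := norm_sub_norm_le p r
            linarith
          simp [h1, h2]
      · rw [integrable_indicator_iff measurableSet_closedBall]
        exact integrableOn_const (by exact (isCompact_closedBall _ _).measure_lt_top.ne)
      · filter_upwards with p
        have : Tendsto (fun r : ℝ × ℝ => |g (p - r) - g p|) (𝓝 0) (𝓝 |g (p - 0) - g p|) := by
          apply Continuous.tendsto
          fun_prop
        simpa using this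
    simpa using this
  have := (key.eventually (gt_mem_nhds (show (0 : ℝ) < η / 2 by positivity)))
  obtain ⟨ε, hε, h⟩ := Metric.eventually_nhds_iff.1 this
  refine ⟨ε, hε, fun r hr => ?_⟩
  have h3 := h (y := r) (by simpa using hr)
  have i1 : Integrable (fun p => |f (p - r) - g (p - r)|) :=
    ((hf.sub hgi).abs).comp_sub_right r
  have i2 : Integrable (fun p => |f p - g p|) := (hf.sub hgi).abs
  have i3 : Integrable (fun p => |g (p - r) - g p|) := ((hgi.comp_sub_right r).sub hgi).abs
  have e1 : ∫ p, |f (p - r) - g (p - r)| = ∫ p, |f p - g p| :=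
    integral_sub_right_eq_self (fun p => |f p - g p|) r
  have e2 : ∫ p, |f p - g p| ≤ η / 4 := by simpa using hfg
  calc ∫ p, |f (p - r) - f p| ≤ ∫ p, (|f (p - r) - g (p - r)| + |f p - g p| + |g (p - r) - g p|) := by
        apply integral_mono
        · exact ((hf.comp_sub_right r).sub hf).abs
        · exact (i1.add i2).add i3
        · intro p
          show |f (p - r) - f p| ≤ |f (p - r) - g (p - r)| + |f p - g p| + |g (p - r) - g p|
          rw [abs_sub_comm (f p)]
          have : f (p - r) - f p = (f (p - r) - g (p - r)) + (g p - f p) + (g (p - r) - g p) := by ring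
          rw [this]
          exact (abs_add_le _ _).trans (add_le_add_left (abs_add_le _ _) _)
    _ = (∫ p, |f (p - r) - g (p - r)|) + (∫ p, |f p - g p|) + ∫ p, |g (p - r) - g p| := by
        rw [← integral_add i1 i2]; exact integral_add (i1.add i2) i3
    _ ≤ η := by rw [e1]; linarith

lemma trans_cont (W : ℝ × ℝ → ℝ) (hW : Measurable W) (B : ℝ) (hB : ∀ p, |W p| ≤ B)
    (K : Set (ℝ × ℝ)) (hK : IsCompact K) (η : ℝ) (hη : 0 < η) :
    ∃ ε > 0, ∀ r : ℝ × ℝ, ‖r‖ < ε → ∫ p in K, |W (p - r) - W p| ≤ η := by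
  obtain ⟨R, hR⟩ := hK.isBounded.subset_closedBall (0 : ℝ × ℝ)
  set f := (Metric.closedBall (0 : ℝ × ℝ) (R + 1)).indicator W with hfdef
  have hf : Integrable f := by
    refine integrable_of_bdd_supp (K := Metric.closedBall (0 : ℝ × ℝ) (R + 1)) ?_
      (isCompact_closedBall _ _).measure_lt_top B ?_ ?_
    · exact (hW.indicator measurableSet_closedBall).aestronglyMeasurable
    · intro p
      classical
      rw [hfdef, indicator_apply]
      split_ifs
      · exact hB p
      · simp; exact (abs_nonneg _).trans (hB p)
    · intro p hp
      rw [hfdef, indicator_of_notMem hp]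
  obtain ⟨ε, hε, h⟩ := trans_cont_integrable f hf η hη
  refine ⟨min ε 1, by positivity, fun r hr => ?_⟩
  have h1 := h r (lt_of_lt_of_le hr (min_le_left _ _))
  have h2 : ‖r‖ < 1 := lt_of_lt_of_le hr (min_le_right _ _)
  refine le_trans ?_ h1
  rw [setIntegral_congr_fun (g := fun p => |f (p - r) - f p|) hK.measurableSet]
  · apply setIntegral_le_integral
    · exact ((hf.comp_sub_right r).sub hf).abs
    · filter_upwards with p
      exact abs_nonneg _
  · intro p hp
    have hp' : ‖p‖ ≤ R := by simpa using hR hp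
    have m1 : p ∈ Metric.closedBall (0 : ℝ × ℝ) (R + 1) := by
      simp; linarith
    have m2 : p - r ∈ Metric.closedBall (0 : ℝ × ℝ) (R + 1) := by
      simp
      have := norm_sub_le p r
      linarith
    simp only [hfdef, indicator_of_mem m1, indicator_of_mem m2]

/-- mollifiers with controlled moment of the derivative -/
lemma exists_kernels : ∃ C' : ℝ, 0 ≤ C' ∧ ∀ ε > 0, ∃ ρ : ℝ × ℝ → ℝ, ContDiff ℝ (⊤ : ℕ∞) ρ ∧
    HasCompactSupport ρ ∧ (∀ r, 0 ≤ ρ r) ∧ tsupport ρ ⊆ Metric.ball 0 ε ∧ (∫ r, ρ r = 1) ∧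
    ∫ r, (ρ r + |r.1| * |fderiv ℝ ρ r (1, 0)|) ≤ C' := by
  let β : ContDiffBump (0 : ℝ × ℝ) := ⟨1/4, 1/2, by norm_num, by norm_num⟩
  let ρ₀ : ℝ × ℝ → ℝ := β.normed volume
  have h0 : ContDiff ℝ (⊤ : ℕ∞) ρ₀ := β.contDiff_normed
  refine ⟨∫ r, (ρ₀ r + |r.1| * |fderiv ℝ ρ₀ r (1, 0)|), ?_, ?_⟩
  · exact integral_nonneg fun r => add_nonneg (β.nonneg_normed r) (by positivity)
  intro ε hε
  have hd : Differentiable ℝ ρ₀ := h0.differentiable (by simp)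
  refine ⟨fun r => (ε ^ 2)⁻¹ * ρ₀ (ε⁻¹ • r), ?_, ?_, ?_, ?_, ?_, ?_⟩
  · exact contDiff_const.mul (h0.comp (contDiff_const_smul ε⁻¹))
  · have := (β.hasCompactSupport_normed (μ := volume)).comp_smul (c := ε⁻¹) (by positivity)
    exact this.mul_left
  · intro r
    exact mul_nonneg (by positivity) (β.nonneg_normed _)
  · have : tsupport (fun r => (ε ^ 2)⁻¹ * ρ₀ (ε⁻¹ • r)) ⊆ Metric.closedBall 0 (ε / 2) := by
      apply closure_minimal _ Metric.isClosed_closedBall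
      intro r hr
      have hr' : ρ₀ (ε⁻¹ • r) ≠ 0 := right_ne_zero_of_mul hr
      have : (ε⁻¹ • r) ∈ Metric.ball (0 : ℝ × ℝ) (1/2) := by
        have h := β.support_normed_eq (μ := volume)
        change _ = Metric.ball (0 : ℝ × ℝ) (1/2) at h
        rw [← h]; exact hr'
      simp only [mem_ball_zero_iff, norm_smul, norm_inv, Real.norm_eq_abs, abs_of_pos hε] at this
      simp only [mem_closedBall_zero_iff]
      rw [inv_mul_lt_iff₀ hε] at this
      linarith
    refine this.trans (Metric.closedBall_subset_ball (by linarith))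
  · rw [integral_const_mul, Measure.integral_comp_inv_smul]
    have : ∫ r, ρ₀ r = 1 := β.integral_normed
    rw [this]
    simp [abs_of_pos hε]
    field_simp
  · have hfd : ∀ r : ℝ × ℝ, fderiv ℝ (fun r => (ε ^ 2)⁻¹ * ρ₀ (ε⁻¹ • r)) r (1, 0)
        = (ε ^ 2)⁻¹ * (ε⁻¹ * fderiv ℝ ρ₀ (ε⁻¹ • r) (1, 0)) := by
      intro r
      rw [fderiv_const_mul (by fun_prop)]
      rw [fderiv_comp_smul]
      simp
    apply le_of_eq
    have : ∀ r : ℝ × ℝ, (ε ^ 2)⁻¹ * ρ₀ (ε⁻¹ • r) +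
        |r.1| * |fderiv ℝ (fun r => (ε ^ 2)⁻¹ * ρ₀ (ε⁻¹ • r)) r (1, 0)|
        = (ε ^ 2)⁻¹ * (fun z : ℝ × ℝ => ρ₀ z + |z.1| * |fderiv ℝ ρ₀ z (1, 0)|) (ε⁻¹ • r) := by
      intro r
      rw [hfd]
      simp only [abs_mul, abs_inv, abs_of_pos hε, abs_pow, Prod.smul_fst, smul_eq_mul]
      ring
    simp_rw [this]
    rw [integral_const_mul, Measure.integral_comp_inv_smul volume
      (fun z : ℝ × ℝ => ρ₀ z + |z.1| * |fderiv ℝ ρ₀ z (1, 0)|)]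
    simp [abs_of_pos hε]
    field_simp

end partOne

section partTwo
open Topology

/-- Nonnegative test functions supported in `O`. -/
def TestOK (O : Set (ℝ × ℝ)) (φ : ℝ × ℝ → ℝ) : Prop :=
  ContDiff ℝ (⊤ : ℕ∞) φ ∧ HasCompactSupport φ ∧ (∀ p, 0 ≤ φ p) ∧ tsupport φ ⊆ O

/-- The other sign function, with value `-1` at `0`. -/
noncomputable def sgnm (s : ℝ) : ℝ := - sgn (-s)

/-- Entropy inequality on the plane, with sign convention `s`. -/
def Ent (s G h : ℝ → ℝ) (O : Set (ℝ × ℝ)) (W : ℝ × ℝ → ℝ) : Prop :=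
  ∀ (k : ℝ) (φ : ℝ × ℝ → ℝ), TestOK O φ →
    0 ≤ ∫ p, (|W p - k| * fderiv ℝ φ p (0, 1)
      + s (W p - k) * (G p.1 * h (W p) - G p.1 * h k) * fderiv ℝ φ p (1, 0)
      - s (W p - k) * deriv G p.1 * h k * φ p)

lemma measurable_sgn : Measurable sgn :=
  Measurable.ite measurableSet_Ici measurable_const measurable_const

lemma abs_sgn (s : ℝ) : |sgn s| = 1 := by
  unfold sgn; split_ifs <;> simp

lemma sgn_mul_self (s : ℝ) : sgn s * s = |s| := by
  unfold sgn; split_ifs with h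
  · rw [abs_of_nonneg h, one_mul]
  · rw [abs_of_neg (not_le.1 h)]; ring

/-- Lipschitz property of the Kruzhkov flux in its second variable -/
lemma Q_lip (h : ℝ → ℝ) (M L : ℝ)
    (hL : ∀ w w', |w| ≤ M → |w'| ≤ M → |h w - h w'| ≤ L * |w - w'|)
    (u v v' : ℝ) (hu : |u| ≤ M) (hv : |v| ≤ M) (hv' : |v'| ≤ M) :
    |sgn (u - v) * (h u - h v) - sgn (u - v') * (h u - h v')| ≤ L * |v - v'| := by
  have h1 := abs_le.1 (hL v v' hv hv')
  have h2 := abs_le.1 (hL u v hu hv)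
  have h3 := abs_le.1 (hL u v' hu hv')
  unfold sgn
  split_ifs with c1 c2 c2
  · exact abs_le.2 ⟨by linarith, by linarith⟩
  · rw [abs_of_nonneg c1] at h2
    rw [abs_of_neg (not_le.1 c2)] at h3
    have : |v - v'| = v' - v := by rw [abs_of_nonpos] <;> linarith
    rw [this]
    have e : L * (v' - v) = L * (u - v) + L * (-(u - v')) := by ring
    rw [e]
    exact abs_le.2 ⟨by linarith, by linarith⟩
  · rw [abs_of_nonneg c2] at h3
    rw [abs_of_neg (not_le.1 c1)] at h2
    have : |v - v'| = v - v' := by rw [abs_of_nonneg]; linarith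
    rw [this]
    have e : L * (v - v') = L * (u - v') + L * (-(u - v)) := by ring
    rw [e]
    exact abs_le.2 ⟨by linarith, by linarith⟩
  · exact abs_le.2 ⟨by linarith, by linarith⟩

lemma integrable_tensor_sub (A c : ℝ × ℝ → ℝ) (hA : Continuous A) (hAc : HasCompactSupport A)
    (hc : Continuous c) (hcc : HasCompactSupport c) :
    Integrable (fun z : (ℝ × ℝ) × (ℝ × ℝ) => A z.1 * c (z.1 - z.2)) := by
  apply Continuous.integrable_of_hasCompactSupport
  · fun_prop
  · have hK : IsCompact ((fun z : (ℝ × ℝ) × (ℝ × ℝ) => (z.1, z.1 - z.2)) ''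
        (tsupport A ×ˢ tsupport c)) := by
      apply (IsCompact.prod hAc hcc).image
      fun_prop
    apply HasCompactSupport.intro hK
    intro z hz
    by_contra hne
    apply hz
    have h1 : A z.1 ≠ 0 := left_ne_zero_of_mul hne
    have h2 : c (z.1 - z.2) ≠ 0 := right_ne_zero_of_mul hne
    exact ⟨(z.1, z.1 - z.2), ⟨subset_tsupport _ h1, subset_tsupport _ h2⟩, by simp⟩

lemma integrable_bdd_mul' {α : Type*} [MeasurableSpace α] {μ : Measure α} {m f : α → ℝ}
    (hf : Integrable f μ) (hm : Measurable m) (B : ℝ) (hB : ∀ z, |m z| ≤ B) :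
    Integrable (fun z => m z * f z) μ :=
  hf.bdd_mul (c := B) hm.aestronglyMeasurable (by filter_upwards with z; simpa using hB z)

lemma test_fderiv_props (ψ : ℝ × ℝ → ℝ) (h1 : ContDiff ℝ (⊤ : ℕ∞) ψ) (h2 : HasCompactSupport ψ)
    (e : ℝ × ℝ) : Continuous (fun p => fderiv ℝ ψ p e) ∧
      HasCompactSupport (fun p => fderiv ℝ ψ p e) ∧
      ∀ p, p ∉ tsupport ψ → fderiv ℝ ψ p e = 0 := by
  refine ⟨(h1.continuous_fderiv (by simp)).clm_apply continuous_const, h2.fderiv_apply ℝ e, ?_⟩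
  intro p hp
  have := support_fderiv_subset ℝ (f := ψ)
  have h3 : fderiv ℝ ψ p = 0 := by
    by_contra h
    exact hp (this h)
  simp [h3]

end partTwo

section partThree
open Topology

lemma abs_sub_le_add (x y : ℝ) : |x - y| ≤ |x| + |y| := by
  simpa using norm_sub_le x y

/-- the p-side integrand in the doubling of variables -/
noncomputable def Jone (G h : ℝ → ℝ) (U V ψ ρ : ℝ × ℝ → ℝ) (p q : ℝ × ℝ) : ℝ :=
  |U p - V q| * (fderiv ℝ ψ p (0, 1) * ρ (p - q) + ψ p * fderiv ℝ ρ (p - q) (0, 1))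
  + sgn (U p - V q) * (G p.1 * h (U p) - G p.1 * h (V q)) *
      (fderiv ℝ ψ p (1, 0) * ρ (p - q) + ψ p * fderiv ℝ ρ (p - q) (1, 0))
  - sgn (U p - V q) * deriv G p.1 * h (V q) * (ψ p * ρ (p - q))

/-- the q-side integrand in the doubling of variables -/
noncomputable def Jtwo (G h : ℝ → ℝ) (U V ψ ρ : ℝ × ℝ → ℝ) (p q : ℝ × ℝ) : ℝ :=
  |V q - U p| * (- (ψ p * fderiv ℝ ρ (p - q) (0, 1)))
  + sgnm (V q - U p) * (G q.1 * h (V q) - G q.1 * h (U p)) *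
      (- (ψ p * fderiv ℝ ρ (p - q) (1, 0)))
  - sgnm (V q - U p) * deriv G q.1 * h (U p) * (ψ p * ρ (p - q))

lemma Jone_nonneg (G h : ℝ → ℝ) (U V ψ ρ : ℝ × ℝ → ℝ) (O : Set (ℝ × ℝ))
    (hU : Ent sgn G h O U) (hψ : TestOK O ψ) (hρ : ContDiff ℝ (⊤ : ℕ∞) ρ) (hρ0 : ∀ r, 0 ≤ ρ r)
    (q : ℝ × ℝ) : 0 ≤ ∫ p, Jone G h U V ψ ρ p q := by
  obtain ⟨h1, h2, h3, h4⟩ := hψ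
  have hρs : ContDiff ℝ (⊤ : ℕ∞) (fun p => ρ (p - q)) := hρ.comp (contDiff_id.sub contDiff_const)
  have ht : TestOK O (fun p => ψ p * ρ (p - q)) := by
    refine ⟨h1.mul hρs, h2.mul_right, fun p => mul_nonneg (h3 p) (hρ0 _), ?_⟩
    exact (tsupport_mul_subset_left).trans h4
  have := hU (V q) _ ht
  have hd : ∀ p e, fderiv ℝ (fun p => ψ p * ρ (p - q)) p e
      = fderiv ℝ ψ p e * ρ (p - q) + ψ p * fderiv ℝ ρ (p - q) e := by
    intro p e
    have d1 : DifferentiableAt ℝ ψ p := h1.differentiable (by simp) p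
    have d2 : DifferentiableAt ℝ (fun p => ρ (p - q)) p := hρs.differentiable (by simp) p
    rw [fderiv_fun_mul d1 d2, fderiv_comp_sub]
    simp
    ring
  simp only [hd] at this
  exact this

lemma Jtwo_nonneg (G h : ℝ → ℝ) (U V ψ ρ : ℝ × ℝ → ℝ) (O : Set (ℝ × ℝ))
    (hV : Ent sgnm G h O V) (hψ : TestOK O ψ) (hρ : ContDiff ℝ (⊤ : ℕ∞) ρ) (hρ0 : ∀ r, 0 ≤ ρ r)
    (hρc : HasCompactSupport ρ)
    (ε : ℝ) (hρs : tsupport ρ ⊆ Metric.ball 0 ε) (hε : ∀ p ∈ tsupport ψ, Metric.ball p ε ⊆ O)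
    (p : ℝ × ℝ) : 0 ≤ ∫ q, Jtwo G h U V ψ ρ p q := by
  obtain ⟨h1, h2, h3, h4⟩ := hψ
  by_cases hp : ψ p = 0
  · simp [Jtwo, hp]
  have hpt : p ∈ tsupport ψ := subset_tsupport _ hp
  have hρs' : ContDiff ℝ (⊤ : ℕ∞) (fun q => ρ (p - q)) := hρ.comp (contDiff_const.sub contDiff_id)
  have hK : IsCompact ((fun r => p - r) '' tsupport ρ) := IsCompact.image hρc (by fun_prop)
  have hsub : Function.support (fun q => ψ p * ρ (p - q)) ⊆ (fun r => p - r) '' tsupport ρ := by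
    intro q hq
    exact ⟨p - q, subset_tsupport _ (right_ne_zero_of_mul hq), by simp⟩
  have ht : TestOK O (fun q => ψ p * ρ (p - q)) := by
    refine ⟨contDiff_const.mul hρs', HasCompactSupport.of_support_subset_isCompact hK hsub,
      fun q => mul_nonneg (h3 p) (hρ0 _), ?_⟩
    refine (closure_minimal hsub hK.isClosed).trans (Subset.trans ?_ (hε p hpt))
    rintro _ ⟨r, hr, rfl⟩
    have := hρs hr
    simpa [dist_eq_norm] using this
  have := hV (U p) _ ht
  have hd : ∀ q e, fderiv ℝ (fun q => ψ p * ρ (p - q)) q e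
      = - (ψ p * fderiv ℝ ρ (p - q) e) := by
    intro q e
    have d2 : DifferentiableAt ℝ (fun q => ρ (p - q)) q := hρs'.differentiable (by simp) q
    rw [fderiv_const_mul d2]
    have d3 : HasFDerivAt ρ (fderiv ℝ ρ (p - q)) (p - q) :=
      (hρ.differentiable (by simp) _).hasFDerivAt
    have d4 : HasFDerivAt (fun q => p - q) (-(ContinuousLinearMap.id ℝ (ℝ × ℝ))) q :=
      (hasFDerivAt_id q).const_sub p
    have d5 : HasFDerivAt (fun q => ρ (p - q)) _ q := d3.comp q d4
    rw [d5.fderiv]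
    simp
  simp only [hd] at this
  exact this

lemma Jsum (G h : ℝ → ℝ) (U V ψ ρ : ℝ × ℝ → ℝ) (p q : ℝ × ℝ) :
    Jone G h U V ψ ρ p q + Jtwo G h U V ψ ρ p q =
      ρ (p - q) * (|U p - V q| * fderiv ℝ ψ p (0, 1)
        + sgn (U p - V q) * (h (U p) - h (V q)) * G p.1 * fderiv ℝ ψ p (1, 0))
      + ψ p * (sgn (U p - V q) * (h (U p) - h (V q)) * (G p.1 - G q.1) * fderiv ℝ ρ (p - q) (1, 0)
        + sgn (U p - V q) * (deriv G q.1 * h (U p) - deriv G p.1 * h (V q)) * ρ (p - q)) := by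
  unfold Jone Jtwo sgnm
  rw [neg_sub, abs_sub_comm (V q)]
  ring

lemma Jone_integrable (G h : ℝ → ℝ) (U V ψ ρ : ℝ × ℝ → ℝ) (BG BD Bh M : ℝ)
    (hGm : Measurable G) (hhm : Measurable h) (hUm : Measurable U) (hVm : Measurable V)
    (hG : ∀ x, |G x| ≤ BG) (hD : ∀ x, |deriv G x| ≤ BD) (hh : ∀ w, |w| ≤ M → |h w| ≤ Bh)
    (hU : ∀ p, |U p| ≤ M) (hV : ∀ p, |V p| ≤ M)
    (hψ : ContDiff ℝ (⊤ : ℕ∞) ψ) (hψc : HasCompactSupport ψ)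
    (hρ : ContDiff ℝ (⊤ : ℕ∞) ρ) (hρc : HasCompactSupport ρ) :
    Integrable (fun z : (ℝ × ℝ) × (ℝ × ℝ) => Jone G h U V ψ ρ z.1 z.2) := by
  obtain ⟨a1, a2, -⟩ := test_fderiv_props ψ hψ hψc (0, 1)
  obtain ⟨b1, b2, -⟩ := test_fderiv_props ψ hψ hψc (1, 0)
  obtain ⟨c1, c2, -⟩ := test_fderiv_props ρ hρ hρc (0, 1)
  obtain ⟨d1, d2, -⟩ := test_fderiv_props ρ hρ hρc (1, 0)
  have hs := measurable_sgn
  have hdm : Measurable (deriv G) := measurable_deriv G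
  have k1 : Integrable (fun z : (ℝ × ℝ) × (ℝ × ℝ) => fderiv ℝ ψ z.1 (0, 1) * ρ (z.1 - z.2) +
      ψ z.1 * fderiv ℝ ρ (z.1 - z.2) (0, 1)) := (integrable_tensor_sub _ _ a1 a2 hρ.continuous hρc).add
    (integrable_tensor_sub _ _ hψ.continuous hψc c1 c2)
  have k2 : Integrable (fun z : (ℝ × ℝ) × (ℝ × ℝ) => fderiv ℝ ψ z.1 (1, 0) * ρ (z.1 - z.2) +
      ψ z.1 * fderiv ℝ ρ (z.1 - z.2) (1, 0)) := (integrable_tensor_sub _ _ b1 b2 hρ.continuous hρc).add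
    (integrable_tensor_sub _ _ hψ.continuous hψc d1 d2)
  have k3 := integrable_tensor_sub _ _ hψ.continuous hψc hρ.continuous hρc
  have hBG : 0 ≤ BG := (abs_nonneg _).trans (hG 0)
  have hBD : 0 ≤ BD := (abs_nonneg _).trans (hD 0)
  have m1 : Measurable (fun z : (ℝ × ℝ) × (ℝ × ℝ) => |U z.1 - V z.2|) := by fun_prop
  have m2 : Measurable (fun z : (ℝ × ℝ) × (ℝ × ℝ) => sgn (U z.1 - V z.2) *
      (G z.1.1 * h (U z.1) - G z.1.1 * h (V z.2))) := by fun_prop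
  have m3 : Measurable (fun z : (ℝ × ℝ) × (ℝ × ℝ) => sgn (U z.1 - V z.2) * deriv G z.1.1 * h (V z.2)) := by
    fun_prop
  simp only [Jone]
  refine Integrable.sub (Integrable.add
    (integrable_bdd_mul' k1 m1 (M + M) ?_)
    (integrable_bdd_mul' k2 m2 (BG * Bh + BG * Bh) ?_))
    (integrable_bdd_mul' k3 m3 (BD * Bh) ?_)
  · intro z
    rw [abs_abs]
    exact (abs_sub_le_add _ _).trans (add_le_add (hU _) (hV _))
  · intro z
    rw [abs_mul, abs_sgn, one_mul]
    refine (abs_sub_le_add _ _).trans (add_le_add ?_ ?_) <;> rw [abs_mul]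
    · exact mul_le_mul (hG _) (hh _ (hU _)) (abs_nonneg _) hBG
    · exact mul_le_mul (hG _) (hh _ (hV _)) (abs_nonneg _) hBG
  · intro z
    rw [abs_mul, abs_mul, abs_sgn, one_mul]
    exact mul_le_mul (hD _) (hh _ (hV _)) (abs_nonneg _) hBD

lemma Jtwo_integrable (G h : ℝ → ℝ) (U V ψ ρ : ℝ × ℝ → ℝ) (BG BD Bh M : ℝ)
    (hGm : Measurable G) (hhm : Measurable h) (hUm : Measurable U) (hVm : Measurable V)
    (hG : ∀ x, |G x| ≤ BG) (hD : ∀ x, |deriv G x| ≤ BD) (hh : ∀ w, |w| ≤ M → |h w| ≤ Bh)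
    (hU : ∀ p, |U p| ≤ M) (hV : ∀ p, |V p| ≤ M)
    (hψ : ContDiff ℝ (⊤ : ℕ∞) ψ) (hψc : HasCompactSupport ψ)
    (hρ : ContDiff ℝ (⊤ : ℕ∞) ρ) (hρc : HasCompactSupport ρ) :
    Integrable (fun z : (ℝ × ℝ) × (ℝ × ℝ) => Jtwo G h U V ψ ρ z.1 z.2) := by
  obtain ⟨c1, c2, -⟩ := test_fderiv_props ρ hρ hρc (0, 1)
  obtain ⟨d1, d2, -⟩ := test_fderiv_props ρ hρ hρc (1, 0)
  have hs := measurable_sgn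
  have hsm : Measurable sgnm := by unfold sgnm; fun_prop
  have hdm : Measurable (deriv G) := measurable_deriv G
  have k1 : Integrable (fun z : (ℝ × ℝ) × (ℝ × ℝ) => -(ψ z.1 * fderiv ℝ ρ (z.1 - z.2) (0, 1))) :=
    (integrable_tensor_sub _ _ hψ.continuous hψc c1 c2).neg
  have k2 : Integrable (fun z : (ℝ × ℝ) × (ℝ × ℝ) => -(ψ z.1 * fderiv ℝ ρ (z.1 - z.2) (1, 0))) :=
    (integrable_tensor_sub _ _ hψ.continuous hψc d1 d2).neg
  have k3 := integrable_tensor_sub _ _ hψ.continuous hψc hρ.continuous hρc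
  have hBG : 0 ≤ BG := (abs_nonneg _).trans (hG 0)
  have hBD : 0 ≤ BD := (abs_nonneg _).trans (hD 0)
  have hsa : ∀ s, |sgnm s| = 1 := by intro s; rw [sgnm, abs_neg, abs_sgn]
  have m1 : Measurable (fun z : (ℝ × ℝ) × (ℝ × ℝ) => |V z.2 - U z.1|) := by fun_prop
  have m2 : Measurable (fun z : (ℝ × ℝ) × (ℝ × ℝ) => sgnm (V z.2 - U z.1) *
      (G z.2.1 * h (V z.2) - G z.2.1 * h (U z.1))) := by fun_prop
  have m3 : Measurable (fun z : (ℝ × ℝ) × (ℝ × ℝ) => sgnm (V z.2 - U z.1) * deriv G z.2.1 * h (U z.1)) := by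
    fun_prop
  simp only [Jtwo]
  refine Integrable.sub (Integrable.add
    (integrable_bdd_mul' k1 m1 (M + M) ?_)
    (integrable_bdd_mul' k2 m2 (BG * Bh + BG * Bh) ?_))
    (integrable_bdd_mul' k3 m3 (BD * Bh) ?_)
  · intro z
    rw [abs_abs]
    exact (abs_sub_le_add _ _).trans (add_le_add (hV _) (hU _))
  · intro z
    rw [abs_mul, hsa, one_mul]
    refine (abs_sub_le_add _ _).trans (add_le_add ?_ ?_) <;> rw [abs_mul]
    · exact mul_le_mul (hG _) (hh _ (hV _)) (abs_nonneg _) hBG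
    · exact mul_le_mul (hG _) (hh _ (hU _)) (abs_nonneg _) hBG
  · intro z
    rw [abs_mul, abs_mul, hsa, one_mul]
    exact mul_le_mul (hD _) (hh _ (hU _)) (abs_nonneg _) hBD

lemma doubling (G h : ℝ → ℝ) (U V ψ ρ : ℝ × ℝ → ℝ) (BG BD Bh M : ℝ)
    (hGm : Measurable G) (hhm : Measurable h) (hUm : Measurable U) (hVm : Measurable V)
    (hG : ∀ x, |G x| ≤ BG) (hD : ∀ x, |deriv G x| ≤ BD) (hh : ∀ w, |w| ≤ M → |h w| ≤ Bh)
    (hU : ∀ p, |U p| ≤ M) (hV : ∀ p, |V p| ≤ M) (O : Set (ℝ × ℝ))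
    (hUe : Ent sgn G h O U) (hVe : Ent sgnm G h O V)
    (hψ : TestOK O ψ)
    (hρ : ContDiff ℝ (⊤ : ℕ∞) ρ) (hρc : HasCompactSupport ρ) (hρ0 : ∀ r, 0 ≤ ρ r)
    (ε : ℝ) (hρs : tsupport ρ ⊆ Metric.ball 0 ε) (hε : ∀ p ∈ tsupport ψ, Metric.ball p ε ⊆ O) :
    0 ≤ ∫ p, ∫ r, (Jone G h U V ψ ρ p (p - r) + Jtwo G h U V ψ ρ p (p - r)) := by
  have i1 := Jone_integrable G h U V ψ ρ BG BD Bh M hGm hhm hUm hVm hG hD hh hU hV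
    hψ.1 hψ.2.1 hρ hρc
  have i2 := Jtwo_integrable G h U V ψ ρ BG BD Bh M hGm hhm hUm hVm hG hD hh hU hV
    hψ.1 hψ.2.1 hρ hρc
  have e : ∀ p, ∫ r, (Jone G h U V ψ ρ p (p - r) + Jtwo G h U V ψ ρ p (p - r))
      = ∫ q, (Jone G h U V ψ ρ p q + Jtwo G h U V ψ ρ p q) := fun p =>
    integral_sub_left_eq_self (fun q => Jone G h U V ψ ρ p q + Jtwo G h U V ψ ρ p q) volume p
  simp_rw [e]
  have n1 : 0 ≤ ∫ z : (ℝ × ℝ) × (ℝ × ℝ), Jone G h U V ψ ρ z.1 z.2 := by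
    rw [Measure.volume_eq_prod] at i1 ⊢
    rw [integral_prod_symm _ i1]
    exact integral_nonneg fun q => Jone_nonneg G h U V ψ ρ O hUe hψ hρ hρ0 q
  have n2 : 0 ≤ ∫ z : (ℝ × ℝ) × (ℝ × ℝ), Jtwo G h U V ψ ρ z.1 z.2 := by
    rw [Measure.volume_eq_prod] at i2 ⊢
    rw [integral_prod _ i2]
    exact integral_nonneg fun p => Jtwo_nonneg G h U V ψ ρ O hVe hψ hρ hρ0 hρc ε hρs hε p
  have i3 := i1.add i2
  have n3 : 0 ≤ ∫ z : (ℝ × ℝ) × (ℝ × ℝ), (Jone G h U V ψ ρ z.1 z.2 + Jtwo G h U V ψ ρ z.1 z.2) := by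
    rw [integral_add i1 i2]; exact add_nonneg n1 n2
  rw [Measure.volume_eq_prod] at n3 i3
  have e3 := integral_prod _ i3
  simp only [Pi.add_apply] at e3
  rw [e3] at n3
  exact n3

end partThree

section partFour
open Topology NNReal

lemma kernel_int (G : ℝ → ℝ) (LG : ℝ≥0) (hG : LipschitzWith LG G) (BG : ℝ) (hB : ∀ x, |G x| ≤ BG)
    (ρ : ℝ × ℝ → ℝ)
    (hρ : ContDiff ℝ (⊤ : ℕ∞) ρ) (hρc : HasCompactSupport ρ) (x : ℝ) :
    ∫ r : ℝ × ℝ, ((G x - G (x - r.1)) * fderiv ℝ ρ r (1, 0) + deriv G (x - r.1) * ρ r) = 0 := by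
  obtain ⟨d1, d2, -⟩ := test_fderiv_props ρ hρ hρc (1, 0)
  have hdm : Measurable (deriv G) := measurable_deriv G
  have hGm : Measurable G := hG.continuous.measurable
  have i1 : Integrable (fun r : ℝ × ℝ => (G x - G (x - r.1)) * fderiv ℝ ρ r (1, 0)) := by
    apply integrable_bdd_mul' (d1.integrable_of_hasCompactSupport d2) (by fun_prop) (BG + BG)
    intro r
    exact (abs_sub_le_add _ _).trans (add_le_add (hB _) (hB _))
  have i2 : Integrable (fun r : ℝ × ℝ => deriv G (x - r.1) * ρ r) := by
    apply integrable_bdd_mul' (hρ.continuous.integrable_of_hasCompactSupport hρc) (by fun_prop) LG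
    intro r
    exact norm_deriv_le_of_lipschitz hG
  rw [integral_add i1 i2]
  obtain ⟨Cρ, hCρ⟩ := hρ.lipschitzWith_of_hasCompactSupport hρc (by simp)
  have hf : LipschitzWith LG (fun r : ℝ × ℝ => G x - G (x - r.1)) := by
    refine LipschitzWith.of_dist_le_mul fun r s => ?_
    have := hG.dist_le_mul (x - r.1) (x - s.1)
    simp only [dist_sub_left] at this ⊢
    exact this.trans (mul_le_mul_of_nonneg_left (le_max_left _ _) LG.2)
  have key := LipschitzWith.integral_lineDeriv_mul_eq (μ := volume) hf hCρ hρc ((1 : ℝ), (0 : ℝ))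
  have l1 : ∀ r : ℝ × ℝ, lineDeriv ℝ (fun r : ℝ × ℝ => G x - G (x - r.1)) r ((1 : ℝ), (0 : ℝ))
      = deriv G (x - r.1) := by
    intro r
    have : (fun t : ℝ => G x - G (x - (r + t • ((1 : ℝ), (0 : ℝ))).1)) =
        fun t => G x - G ((x - r.1) - t) := by
      funext t; congr 2; simp; ring
    rw [lineDeriv, this, deriv_const_sub, deriv_comp_const_sub]
    simp
  have l2 : ∀ r : ℝ × ℝ, lineDeriv ℝ ρ r (-((1 : ℝ), (0 : ℝ))) = - fderiv ℝ ρ r (1, 0) := by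
    intro r
    rw [((hρ.differentiable (by simp)) r).lineDeriv_eq_fderiv, map_neg]
  simp only [l1, l2] at key
  rw [key, ← integral_add i1]
  · simp [mul_comm]
  · have := i1.neg
    refine this.congr ?_
    filter_upwards with r
    simp [mul_comm]

end partFour

section partFive
open Topology NNReal

lemma abs_mul_le_mul' {x y B C : ℝ} (hx : |x| ≤ B) (hy : |y| ≤ C) : |x * y| ≤ B * C := by
  rw [abs_mul]
  exact mul_le_mul hx hy (abs_nonneg _) ((abs_nonneg _).trans hx)

/-- purely algebraic pointwise estimate in the doubling of variables -/
lemma doubling_pointwise (r rx r1 pt px ps sr Qr Q Gx Gy Dr D hU hVr a0 ar d Lh LG BG Bh Bψ : ℝ)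
    (hr : 0 ≤ r) (hLh : 0 ≤ Lh)
    (hpt : |pt| ≤ Bψ) (hpx : |px| ≤ Bψ) (hps : |ps| ≤ Bψ) (hsr : |sr| = 1)
    (hQ : |Qr - Q| ≤ Lh * d) (hd : 0 ≤ d) (ha : |ar - a0| ≤ d) (hG : |Gx| ≤ BG)
    (hGG : |Gx - Gy| ≤ LG * |r1|) (hDr : |Dr| ≤ LG) (hhV : |hVr| ≤ Bh)
    (hQr : Qr = sr * (hU - hVr)) :
    r * (ar * pt + Qr * Gx * px) + ps * (Qr * (Gx - Gy) * rx + sr * (Dr * hU - D * hVr) * r)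
    ≤ r * (a0 * pt + Q * Gx * px) + ps * Q * ((Gx - Gy) * rx + Dr * r)
      + Bψ * (1 + Lh * BG + Lh * LG + Bh) * (r + |r1| * |rx|) * (d + |Dr - D|) := by
  have hB : 0 ≤ Bψ := (abs_nonneg _).trans hps
  have hBG : 0 ≤ BG := (abs_nonneg _).trans hG
  have hBh : 0 ≤ Bh := (abs_nonneg _).trans hhV
  have hLG : 0 ≤ LG := (abs_nonneg _).trans hDr
  set N := r + |r1| * |rx| with hN
  have hn : 0 ≤ |r1| * |rx| := by positivity
  have hrN : r ≤ N := by linarith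
  have hN0 : 0 ≤ N := by linarith
  set e := |Dr - D| with he
  have he0 : 0 ≤ e := abs_nonneg _
  have hk : |(Gx - Gy) * rx + Dr * r| ≤ LG * N := by
    refine (abs_add_le _ _).trans ?_
    have h1 := abs_mul_le_mul' hGG (le_refl |rx|)
    have h2 := abs_mul_le_mul' hDr (le_of_eq (abs_of_nonneg hr))
    calc _ ≤ _ := add_le_add h1 h2
      _ = LG * N := by rw [hN]; ring
  have hra : |r| ≤ N := by rw [abs_of_nonneg hr]; exact hrN
  have t1 : |r * ((ar - a0) * pt)| ≤ N * (d * Bψ) := abs_mul_le_mul' hra (abs_mul_le_mul' ha hpt)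
  have t2 : |r * ((Qr - Q) * Gx * px)| ≤ N * (Lh * d * BG * Bψ) :=
    abs_mul_le_mul' hra (abs_mul_le_mul' (abs_mul_le_mul' hQ hG) hpx)
  have t3 : |ps * ((Qr - Q) * ((Gx - Gy) * rx + Dr * r))| ≤ Bψ * (Lh * d * (LG * N)) :=
    abs_mul_le_mul' hps (abs_mul_le_mul' hQ hk)
  have t4 : |ps * (sr * ((Dr - D) * hVr * r))| ≤ Bψ * (1 * (e * Bh * N)) :=
    abs_mul_le_mul' hps (abs_mul_le_mul' hsr.le (abs_mul_le_mul' (abs_mul_le_mul' le_rfl hhV) hra))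
  have id1 : r * (ar * pt + Qr * Gx * px)
      + ps * (Qr * (Gx - Gy) * rx + sr * (Dr * hU - D * hVr) * r)
      = r * (a0 * pt + Q * Gx * px) + ps * Q * ((Gx - Gy) * rx + Dr * r)
        + (r * ((ar - a0) * pt) + r * ((Qr - Q) * Gx * px)
          + ps * ((Qr - Q) * ((Gx - Gy) * rx + Dr * r)) + ps * (sr * ((Dr - D) * hVr * r))) := by
    have : sr * (Dr * hU - D * hVr) = Dr * Qr + sr * ((Dr - D) * hVr) := by rw [hQr]; ring
    rw [this]; ring
  rw [id1]
  have l1 := (abs_le.1 t1).2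
  have l2 := (abs_le.1 t2).2
  have l3 := (abs_le.1 t3).2
  have l4 := (abs_le.1 t4).2
  have fin : N * (d * Bψ) + N * (Lh * d * BG * Bψ) + Bψ * (Lh * d * (LG * N)) +
      Bψ * (1 * (e * Bh * N)) ≤ Bψ * (1 + Lh * BG + Lh * LG + Bh) * N * (d + e) := by
    have : Bψ * (1 + Lh * BG + Lh * LG + Bh) * N * (d + e) =
      N * (d * Bψ) + N * (Lh * d * BG * Bψ) + Bψ * (Lh * d * (LG * N)) + Bψ * (1 * (e * Bh * N))
      + (Bψ * N * Bh * d + Bψ * N * (1 + Lh * BG + Lh * LG) * e) := by ring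
    rw [this]
    have : 0 ≤ Bψ * N * Bh * d + Bψ * N * (1 + Lh * BG + Lh * LG) * e := by positivity
    linarith
  linarith

lemma mp_shear : MeasurePreserving (fun z : (ℝ × ℝ) × (ℝ × ℝ) => (z.1, z.1 - z.2)) := by
  have h1 := measurePreserving_prod_add (volume : Measure (ℝ × ℝ)) (volume : Measure (ℝ × ℝ))
  have h2 := (MeasurePreserving.id (volume : Measure (ℝ × ℝ))).prod
    (Measure.measurePreserving_neg (volume : Measure (ℝ × ℝ)))
  have h3 := h1.comp h2
  have e : ((fun z : (ℝ × ℝ) × (ℝ × ℝ) => (z.1, z.1 + z.2)) ∘ (Prod.map id Neg.neg))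
      = (fun z : (ℝ × ℝ) × (ℝ × ℝ) => (z.1, z.1 - z.2)) := by
    funext z; simp [sub_eq_add_neg]
  rw [e] at h3
  exact h3

theorem kato_abstract (G h : ℝ → ℝ) (U V : ℝ × ℝ → ℝ) (LG : ℝ≥0) (BG Bh Lh M : ℝ) (hLh : 0 ≤ Lh)
    (hGL : LipschitzWith LG G) (hG : ∀ x, |G x| ≤ BG)
    (hhm : Measurable h) (hUm : Measurable U) (hVm : Measurable V)
    (hh : ∀ w, |w| ≤ M → |h w| ≤ Bh)
    (hhL : ∀ w w', |w| ≤ M → |w'| ≤ M → |h w - h w'| ≤ Lh * |w - w'|)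
    (hU : ∀ p, |U p| ≤ M) (hV : ∀ p, |V p| ≤ M) (O : Set (ℝ × ℝ)) (hO : IsOpen O)
    (hUe : Ent sgn G h O U) (hVe : Ent sgnm G h O V)
    (ψ : ℝ × ℝ → ℝ) (hψ : TestOK O ψ) :
    0 ≤ ∫ p, (|U p - V p| * fderiv ℝ ψ p (0, 1)
      + sgn (U p - V p) * (h (U p) - h (V p)) * G p.1 * fderiv ℝ ψ p (1, 0)) := by
  have hGm : Measurable G := hGL.continuous.measurable
  have hD : ∀ x, |deriv G x| ≤ LG := fun x => norm_deriv_le_of_lipschitz hGL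
  have hdm : Measurable (deriv G) := measurable_deriv G
  have hs := measurable_sgn
  obtain ⟨a1, a2, a3⟩ := test_fderiv_props ψ hψ.1 hψ.2.1 (0, 1)
  obtain ⟨b1, b2, b3⟩ := test_fderiv_props ψ hψ.1 hψ.2.1 (1, 0)
  obtain ⟨B1, hB1⟩ := a1.bounded_above_of_compact_support a2
  obtain ⟨B2, hB2⟩ := b1.bounded_above_of_compact_support b2
  obtain ⟨B3, hB3⟩ := hψ.1.continuous.bounded_above_of_compact_support hψ.2.1
  simp only [Real.norm_eq_abs] at hB1 hB2 hB3
  set Bψ := max B1 (max B2 B3) with hBψ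
  have hB0 : 0 ≤ Bψ := (abs_nonneg _).trans ((hB1 0).trans (le_max_left _ _))
  have hBG0 : 0 ≤ BG := (abs_nonneg _).trans (hG 0)
  have hBh0 : 0 ≤ Bh := (abs_nonneg _).trans (hh _ (hU 0))
  set K := tsupport ψ with hK
  have hKc : IsCompact K := hψ.2.1
  obtain ⟨ε₀, hε₀, hthick⟩ := hKc.exists_thickening_subset_open hO hψ.2.2.2
  have hball : ∀ p ∈ K, Metric.ball p ε₀ ⊆ O := fun p hp =>
    (Metric.ball_subset_thickening hp ε₀).trans hthick
  obtain ⟨C', hC', hker⟩ := exists_kernels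
  set A : ℝ × ℝ → ℝ := fun p => |U p - V p| * fderiv ℝ ψ p (0, 1)
      + sgn (U p - V p) * (h (U p) - h (V p)) * G p.1 * fderiv ℝ ψ p (1, 0) with hA
  set Cc := Bψ * (1 + Lh * BG + Lh * LG + Bh) with hCc
  have hCc0 : 0 ≤ Cc := by positivity
  -- integrability of A
  have hQm : Measurable (fun p => sgn (U p - V p) * (h (U p) - h (V p))) := by fun_prop
  have hQb : ∀ p, |sgn (U p - V p) * (h (U p) - h (V p))| ≤ Bh + Bh := by
    intro p
    rw [abs_mul, abs_sgn, one_mul]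
    exact (abs_sub_le_add _ _).trans (add_le_add (hh _ (hU _)) (hh _ (hV _)))
  have hAi : Integrable A := by
    refine Integrable.add
      (integrable_bdd_mul' (a1.integrable_of_hasCompactSupport a2) (by fun_prop) (M + M) ?_)
      (integrable_bdd_mul' (b1.integrable_of_hasCompactSupport b2) (by fun_prop)
        ((Bh + Bh) * BG) ?_)
    · intro p
      rw [abs_abs]
      exact (abs_sub_le_add _ _).trans (add_le_add (hU _) (hV _))
    · intro p
      exact abs_mul_le_mul' (hQb p) (hG _)
  suffices H : ∀ η > 0, 0 ≤ (∫ p, A p) + Cc * (η + η) * C' by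
    by_contra hneg
    push Not at hneg
    have hpos : 0 < 2 * (Cc * C') + 1 := by positivity
    have := H (-(∫ p, A p) / 2 / (2 * (Cc * C') + 1)) (by
      apply div_pos _ hpos; linarith)
    have e : Cc * (-(∫ p, A p) / 2 / (2 * (Cc * C') + 1) + -(∫ p, A p) / 2 / (2 * (Cc * C') + 1)) * C'
        = (-(∫ p, A p) / 2) * ((2 * (Cc * C')) / (2 * (Cc * C') + 1)) := by
      field_simp; ring
    rw [e] at this
    have le1 : (2 * (Cc * C')) / (2 * (Cc * C') + 1) ≤ 1 := by
      rw [div_le_one hpos]; linarith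
    have := mul_le_mul_of_nonneg_left le1 (show 0 ≤ -(∫ p, A p) / 2 by linarith)
    linarith
  intro η hη
  obtain ⟨ε₁, hε₁, ht1⟩ := trans_cont V hVm M hV K hKc η hη
  obtain ⟨ε₂, hε₂, ht2⟩ := trans_cont (fun p => deriv G p.1) (by fun_prop) LG
    (fun p => hD _) K hKc η hη
  set ε := min ε₀ (min ε₁ ε₂) with hε
  have hεpos : 0 < ε := by positivity
  obtain ⟨ρ, hρ, hρc, hρ0, hρs, hρ1, hρN⟩ := hker ε hεpos
  obtain ⟨d1, d2, d3⟩ := test_fderiv_props ρ hρ hρc (1, 0)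
  have hball' : ∀ p ∈ K, Metric.ball p ε ⊆ O := fun p hp =>
    (Metric.ball_subset_ball (min_le_left _ _)).trans (hball p hp)
  have dbl := doubling G h U V ψ ρ BG LG Bh M hGm hhm hUm hVm hG hD hh hU hV O hUe hVe hψ hρ hρc hρ0
    ε hρs hball'
  have iJ := (Jone_integrable G h U V ψ ρ BG LG Bh M hGm hhm hUm hVm hG hD hh hU hV
    hψ.1 hψ.2.1 hρ hρc).add (Jtwo_integrable G h U V ψ ρ BG LG Bh M hGm hhm hUm hVm hG hD hh hU hV
    hψ.1 hψ.2.1 hρ hρc)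
  have iI : Integrable (fun z : (ℝ × ℝ) × (ℝ × ℝ) =>
      Jone G h U V ψ ρ z.1 (z.1 - z.2) + Jtwo G h U V ψ ρ z.1 (z.1 - z.2)) :=
    mp_shear.integrable_comp_of_integrable iJ
  have dbl' : 0 ≤ ∫ z : (ℝ × ℝ) × (ℝ × ℝ),
      (Jone G h U V ψ ρ z.1 (z.1 - z.2) + Jtwo G h U V ψ ρ z.1 (z.1 - z.2)) := by
    rw [Measure.volume_eq_prod] at iI ⊢
    rw [integral_prod _ iI]
    exact dbl
  -- the main part and the error
  set N : ℝ × ℝ → ℝ := fun r => ρ r + |r.1| * |fderiv ℝ ρ r (1, 0)| with hN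
  have hNc : Continuous N := by
    have := hρ.continuous
    fun_prop
  have hN0 : ∀ r, 0 ≤ N r := fun r => add_nonneg (hρ0 r) (by positivity)
  have hNz : ∀ r, r ∉ tsupport ρ → N r = 0 := by
    intro r hr
    simp [hN, d3 r hr, image_eq_zero_of_notMem_tsupport hr]
  have hNi : Integrable N :=
    hNc.integrable_of_hasCompactSupport (HasCompactSupport.intro hρc hNz)
  set I0 : (ℝ × ℝ) × (ℝ × ℝ) → ℝ := fun z => A z.1 * ρ z.2 +
    ψ z.1 * (sgn (U z.1 - V z.1) * (h (U z.1) - h (V z.1))) *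
      ((G z.1.1 - G (z.1.1 - z.2.1)) * fderiv ℝ ρ z.2 (1, 0) + deriv G (z.1.1 - z.2.1) * ρ z.2)
    with hI0
  set Er : (ℝ × ℝ) × (ℝ × ℝ) → ℝ := fun z =>
    (|V (z.1 - z.2) - V z.1| + |deriv G (z.1 - z.2).1 - deriv G z.1.1|) *
      (K.indicator (fun _ => (1 : ℝ)) z.1 * (Cc * N z.2)) with hEr
  have hpt : ∀ z : (ℝ × ℝ) × (ℝ × ℝ),
      Jone G h U V ψ ρ z.1 (z.1 - z.2) + Jtwo G h U V ψ ρ z.1 (z.1 - z.2) ≤ I0 z + Er z := by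
    rintro ⟨p, r⟩
    rw [Jsum]
    simp only [hI0, hEr, hA, sub_sub_cancel]
    by_cases hp : p ∈ K
    · rw [indicator_of_mem hp, one_mul]
      have hdp := doubling_pointwise (ρ r) (fderiv ℝ ρ r (1, 0)) r.1 (fderiv ℝ ψ p (0, 1))
        (fderiv ℝ ψ p (1, 0)) (ψ p) (sgn (U p - V (p - r)))
        (sgn (U p - V (p - r)) * (h (U p) - h (V (p - r))))
        (sgn (U p - V p) * (h (U p) - h (V p))) (G p.1) (G (p.1 - r.1)) (deriv G (p.1 - r.1))
        (deriv G p.1) (h (U p)) (h (V (p - r))) |U p - V p| |U p - V (p - r)| |V (p - r) - V p|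
        Lh LG BG Bh Bψ (hρ0 r) hLh ((hB1 p).trans (le_max_left _ _))
        ((hB2 p).trans ((le_max_left _ _).trans (le_max_right _ _)))
        ((hB3 p).trans ((le_max_right _ _).trans (le_max_right _ _))) (abs_sgn _)
        (Q_lip h M Lh hhL _ _ _ (hU _) (hV _) (hV _)) (abs_nonneg _)
        (by
          have := abs_abs_sub_abs_le (U p - V (p - r)) (U p - V p)
          rw [sub_sub_sub_cancel_left, abs_sub_comm] at this
          rw [abs_sub_comm]
          rw [abs_sub_comm (V (p - r))]
          rw [abs_sub_comm |U p - V p|, abs_sub_comm (V p)]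
          simpa [abs_sub_comm] using this)
        (hG _)
        (by
          have := hGL.dist_le_mul p.1 (p.1 - r.1)
          simpa [Real.dist_eq] using this)
        (hD _) (hh _ (hV _)) rfl
      simp only [Prod.fst_sub]
      refine hdp.trans (le_of_eq ?_)
      ring
    · have z1 : ψ p = 0 := image_eq_zero_of_notMem_tsupport hp
      simp [z1, a3 p hp, b3 p hp, indicator_of_notMem hp]
  have hψi : Integrable ψ := hψ.1.continuous.integrable_of_hasCompactSupport hψ.2.1
  have hρi : Integrable ρ := hρ.continuous.integrable_of_hasCompactSupport hρc
  have hρxi : Integrable (fun r => fderiv ℝ ρ r (1, 0)) := d1.integrable_of_hasCompactSupport d2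
  have i0a : Integrable (fun z : (ℝ × ℝ) × (ℝ × ℝ) => A z.1 * ρ z.2) := hAi.mul_prod hρi
  have hψQi : Integrable (fun p => ψ p * (sgn (U p - V p) * (h (U p) - h (V p)))) := by
    have := integrable_bdd_mul' hψi hQm _ hQb
    simpa [mul_comm] using this
  have i0b : Integrable (fun z : (ℝ × ℝ) × (ℝ × ℝ) =>
      ψ z.1 * (sgn (U z.1 - V z.1) * (h (U z.1) - h (V z.1))) *
      ((G z.1.1 - G (z.1.1 - z.2.1)) * fderiv ℝ ρ z.2 (1, 0) + deriv G (z.1.1 - z.2.1) * ρ z.2)) := by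
    have e1 : Integrable (fun z : (ℝ × ℝ) × (ℝ × ℝ) => (G z.1.1 - G (z.1.1 - z.2.1)) *
        (ψ z.1 * (sgn (U z.1 - V z.1) * (h (U z.1) - h (V z.1))) * fderiv ℝ ρ z.2 (1, 0))) := by
      refine integrable_bdd_mul' (hψQi.mul_prod hρxi) (by fun_prop) (BG + BG) ?_
      intro z
      exact (abs_sub_le_add _ _).trans (add_le_add (hG _) (hG _))
    have e2 : Integrable (fun z : (ℝ × ℝ) × (ℝ × ℝ) => (deriv G (z.1.1 - z.2.1)) *
        (ψ z.1 * (sgn (U z.1 - V z.1) * (h (U z.1) - h (V z.1))) * ρ z.2)) := by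
      refine integrable_bdd_mul' (hψQi.mul_prod hρi) (by fun_prop) LG ?_
      intro z
      exact hD _
    refine (e1.add e2).congr ?_
    filter_upwards with z
    simp only [Pi.add_apply]
    ring
  have iI0 : Integrable I0 := i0a.add i0b
  have iE0 : Integrable (fun z : (ℝ × ℝ) × (ℝ × ℝ) =>
      K.indicator (fun _ => (1 : ℝ)) z.1 * (Cc * N z.2)) := by
    refine Integrable.mul_prod (f := K.indicator (fun _ => (1 : ℝ))) (g := fun r => Cc * N r)
      ?_ (hNi.const_mul _)
    rw [integrable_indicator_iff hKc.measurableSet]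
    exact integrableOn_const hKc.measure_lt_top.ne
  have iEr : Integrable Er := by
    refine integrable_bdd_mul' iE0 (by fun_prop) ((M + M) + (LG + LG)) ?_
    intro z
    refine (abs_add_le _ _).trans (add_le_add ?_ ?_)
    · rw [abs_abs]
      exact (abs_sub_le_add _ _).trans (add_le_add (hV _) (hV _))
    · rw [abs_abs]
      exact (abs_sub_le_add _ _).trans (add_le_add (hD _) (hD _))
  have eI0 : ∫ z, I0 z = ∫ p, A p := by
    rw [Measure.volume_eq_prod] at iI0 ⊢
    rw [integral_prod _ iI0]
    apply integral_congr_ae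
    rw [Measure.volume_eq_prod] at i0a i0b
    filter_upwards [i0a.prod_right_ae, i0b.prod_right_ae] with p h1 h2
    simp only [hI0]
    rw [integral_add h1 h2, integral_const_mul, integral_const_mul, hρ1,
      kernel_int G LG hGL BG hG ρ hρ hρc p.1]
    ring
  have eEr : ∫ z, Er z ≤ Cc * (η + η) * C' := by
    rw [Measure.volume_eq_prod] at iEr ⊢
    rw [integral_prod_symm _ iEr]
    have step : ∀ r, ∫ p, Er (p, r) ≤ (Cc * (η + η)) * N r := by
      intro r
      have e1 : ∫ p, Er (p, r) = (∫ p in K, (|V (p - r) - V p| +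
          |deriv G (p - r).1 - deriv G p.1|)) * (Cc * N r) := by
        rw [← integral_mul_const, ← integral_indicator hKc.measurableSet]
        congr 1
        funext p
        simp only [hEr]
        by_cases hp : p ∈ K
        · simp [indicator_of_mem hp]
        · simp [indicator_of_notMem hp]
      rw [e1]
      by_cases hr : r ∈ tsupport ρ
      · have hr' : ‖r‖ < ε := by simpa using hρs hr
        have q1 := ht1 r (hr'.trans_le ((min_le_right _ _).trans (min_le_left _ _)))
        have q2 := ht2 r (hr'.trans_le ((min_le_right _ _).trans (min_le_right _ _)))
        have q3 : IntegrableOn (fun p => |V (p - r) - V p|) K := by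
          refine Measure.integrableOn_of_bounded (M := M + M) hKc.measure_lt_top.ne
            (Measurable.aestronglyMeasurable (by fun_prop)) ?_
          filter_upwards with p
          rw [Real.norm_eq_abs, abs_abs]
          exact (abs_sub_le_add _ _).trans (add_le_add (hV _) (hV _))
        have q4 : IntegrableOn (fun p : ℝ × ℝ => |deriv G (p - r).1 - deriv G p.1|) K := by
          refine Measure.integrableOn_of_bounded (M := LG + LG) hKc.measure_lt_top.ne
            (Measurable.aestronglyMeasurable (by fun_prop)) ?_
          filter_upwards with p
          rw [Real.norm_eq_abs, abs_abs]
          exact (abs_sub_le_add _ _).trans (add_le_add (hD _) (hD _))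
        rw [integral_add q3 q4]
        calc _ ≤ (η + η) * (Cc * N r) :=
              mul_le_mul_of_nonneg_right (add_le_add q1 q2) (mul_nonneg hCc0 (hN0 r))
          _ = _ := by ring
      · simp [hNz r hr]
    calc _ ≤ ∫ r, (Cc * (η + η)) * N r := by
          apply integral_mono _ (hNi.const_mul _) step
          exact iEr.integral_prod_right
      _ = (Cc * (η + η)) * ∫ r, N r := integral_const_mul _ _
      _ ≤ _ := mul_le_mul_of_nonneg_left hρN (by positivity)
  calc 0 ≤ _ := dbl'
    _ ≤ ∫ z, (I0 z + Er z) := integral_mono iI (iI0.add iEr) hpt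
    _ = (∫ z, I0 z) + ∫ z, Er z := integral_add iI0 iEr
    _ ≤ _ := by rw [eI0]; linarith

end partFive

section partSix
open Topology NNReal

lemma h_coercive (h : ℝ → ℝ) (hh : ContDiff ℝ 2 h) (hS' : deriv h 0 = 0)
    (hSC : StrictMono (deriv h)) (C : ℝ) (hC : 0 ≤ C) :
    ∃ M : ℝ, 0 ≤ M ∧ ∀ w, |h w| ≤ C → |w| ≤ M := by
  have hd : Differentiable ℝ h := hh.differentiable (by simp)
  have p1 : 0 < deriv h 1 := by rw [← hS']; exact hSC one_pos
  have p2 : 0 < - deriv h (-1) := by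
    have : deriv h (-1) < 0 := by rw [← hS']; exact hSC (by norm_num)
    linarith
  have t1 : 0 ≤ (C + |h 1|) / deriv h 1 := by positivity
  have t2 : 0 ≤ (C + |h (-1)|) / (-deriv h (-1)) := by positivity
  refine ⟨1 + (C + |h 1|) / deriv h 1 + (C + |h (-1)|) / (-deriv h (-1)), by positivity, ?_⟩
  intro w hw
  have hw' := abs_le.1 hw
  apply abs_le.2
  constructor
  · by_cases hw1 : -1 ≤ w
    · linarith
    push Not at hw1
    have := Convex.image_sub_le_mul_sub_of_deriv_le (convex_Iic (-1 : ℝ)) (f := h)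
      hd.continuous.continuousOn hd.differentiableOn (C := deriv h (-1)) (by
        intro x hx
        rw [interior_Iic] at hx
        exact hSC.monotone (le_of_lt hx)) w (le_of_lt hw1) (-1) (by simp) hw1.le
    have q : (-1 - w) ≤ (C + |h (-1)|) / (-deriv h (-1)) := by
      rw [le_div_iff₀ p2]
      have := neg_abs_le (h (-1))
      nlinarith
    linarith
  · by_cases hw1 : w ≤ 1
    · linarith
    push Not at hw1
    have := Convex.mul_sub_le_image_sub_of_le_deriv (convex_Ici (1 : ℝ)) (f := h)
      hd.continuous.continuousOn hd.differentiableOn (C := deriv h 1) (by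
        intro x hx
        rw [interior_Ici] at hx
        exact hSC.monotone (le_of_lt hx)) 1 (by simp) w (le_of_lt hw1) hw1.le
    have q : (w - 1) ≤ (C + |h 1|) / deriv h 1 := by
      rw [le_div_iff₀ p1]
      have := neg_abs_le (h 1)
      nlinarith
    linarith

lemma ent_sgnm (G h : ℝ → ℝ) (W : ℝ × ℝ → ℝ) (BG BD M : ℝ) (O : Set (ℝ × ℝ))
    (hGm : Measurable G) (hhc : Continuous h) (hWm : Measurable W)
    (hG : ∀ x, |G x| ≤ BG) (hD : ∀ x, |deriv G x| ≤ BD)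
    (hW : ∀ p, |W p| ≤ M) (hE : Ent sgn G h O W) : Ent sgnm G h O W := by
  intro k φ hφ
  have hs := measurable_sgn
  have hdm : Measurable (deriv G) := measurable_deriv G
  have hhm : Measurable h := hhc.measurable
  obtain ⟨a1, a2, a3⟩ := test_fderiv_props φ hφ.1 hφ.2.1 (0, 1)
  obtain ⟨b1, b2, b3⟩ := test_fderiv_props φ hφ.1 hφ.2.1 (1, 0)
  obtain ⟨Bh, hBh⟩ := (isCompact_Icc (a := -M) (b := M)).exists_bound_of_continuousOn
    (f := h) hhc.continuousOn
  obtain ⟨Bk, hBk⟩ := (isCompact_Icc (a := k) (b := k + 1)).exists_bound_of_continuousOn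
    (f := h) hhc.continuousOn
  have hBG : 0 ≤ BG := (abs_nonneg _).trans (hG 0)
  have hBD : 0 ≤ BD := (abs_nonneg _).trans (hD 0)
  set kn : ℕ → ℝ := fun n => k + 1 / ((n : ℝ) + 1) with hkn
  have hkt : Tendsto kn atTop (𝓝 k) := by
    have := (tendsto_one_div_add_atTop_nhds_zero_nat (𝕜 := ℝ)).const_add k
    rw [add_zero] at this
    exact this
  have hkp : ∀ n, k < kn n := fun n => by
    have : 0 < 1 / ((n : ℝ) + 1) := by positivity
    simp only [hkn]; linarith
  have hk1 : ∀ n, kn n ≤ k + 1 := fun n => by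
    have : 1 / ((n : ℝ) + 1) ≤ 1 := by
      rw [div_le_one (by positivity)]; linarith [Nat.cast_nonneg (α := ℝ) n]
    simp only [hkn]; linarith
  have lim : Tendsto (fun n => ∫ p, (|W p - kn n| * fderiv ℝ φ p (0, 1)
      + sgn (W p - kn n) * (G p.1 * h (W p) - G p.1 * h (kn n)) * fderiv ℝ φ p (1, 0)
      - sgn (W p - kn n) * deriv G p.1 * h (kn n) * φ p)) atTop
      (𝓝 (∫ p, (|W p - k| * fderiv ℝ φ p (0, 1)
      + sgnm (W p - k) * (G p.1 * h (W p) - G p.1 * h k) * fderiv ℝ φ p (1, 0)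
      - sgnm (W p - k) * deriv G p.1 * h k * φ p))) := by
    have m1 : Measurable (fun p => fderiv ℝ φ p (0, 1)) := a1.measurable
    have m2 : Measurable (fun p => fderiv ℝ φ p (1, 0)) := b1.measurable
    have m3 : Measurable φ := hφ.1.continuous.measurable
    apply tendsto_integral_of_dominated_convergence
      (bound := fun p => (M + (|k| + 1)) * |fderiv ℝ φ p (0, 1)|
        + (BG * Bh + BG * Bk) * |fderiv ℝ φ p (1, 0)| + BD * Bk * |φ p|)
    · intro n
      apply Measurable.aestronglyMeasurable
      fun_prop
    · refine Integrable.add (Integrable.add ?_ ?_) ?_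
      · exact (a1.integrable_of_hasCompactSupport a2).abs.const_mul _
      · exact (b1.integrable_of_hasCompactSupport b2).abs.const_mul _
      · exact (hφ.1.continuous.integrable_of_hasCompactSupport hφ.2.1).abs.const_mul _
    · intro n
      filter_upwards with p
      rw [Real.norm_eq_abs]
      have hWh : |h (W p)| ≤ Bh := hBh _ (abs_le.1 (hW p))
      have hkh : |h (kn n)| ≤ Bk := hBk _ ⟨(hkp n).le, hk1 n⟩
      have hka : |kn n| ≤ |k| + 1 := by
        have h1 := abs_le.1 (le_refl |k|)
        have := hkp n
        have := hk1 n
        exact abs_le.2 ⟨by linarith, by linarith⟩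
      refine (abs_sub_le_add _ _).trans (add_le_add ((abs_add_le _ _).trans (add_le_add ?_ ?_)) ?_)
      · refine abs_mul_le_mul' ?_ le_rfl
        rw [abs_abs]
        exact (abs_sub_le_add _ _).trans (add_le_add (hW p) hka)
      · refine abs_mul_le_mul' ?_ le_rfl
        rw [abs_mul, abs_sgn, one_mul]
        exact (abs_sub_le_add _ _).trans
          (add_le_add (abs_mul_le_mul' (hG _) hWh) (abs_mul_le_mul' (hG _) hkh))
      · refine abs_mul_le_mul' (abs_mul_le_mul' ?_ hkh) le_rfl
        rw [abs_mul, abs_sgn, one_mul]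
        exact hD _
    · filter_upwards with p
      have s1 : Tendsto (fun n => sgn (W p - kn n)) atTop (𝓝 (sgnm (W p - k))) := by
        apply tendsto_const_nhds.congr'
        by_cases hwk : k < W p
        · filter_upwards [hkt.eventually (gt_mem_nhds hwk)] with n hn
          unfold sgnm sgn
          rw [if_neg (by linarith), if_pos (by linarith)]; simp
        · push Not at hwk
          filter_upwards with n
          have := hkp n
          unfold sgnm sgn
          rw [if_pos (by linarith), if_neg (by linarith)]
      have s2 : Tendsto (fun n => h (kn n)) atTop (𝓝 (h k)) := (hhc.tendsto k).comp hkt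
      have s3 : Tendsto (fun n => |W p - kn n|) atTop (𝓝 |W p - k|) := (hkt.const_sub _).abs
      exact ((s3.mul_const _).add ((s1.mul ((s2.const_mul _).const_sub _)).mul_const _)).sub
        (((s1.mul_const _).mul s2).mul_const _)
  exact ge_of_tendsto' lim fun n => hE (kn n) φ hφ

lemma ent_of_interior (g h : ℝ → ℝ) (a b T a' b' M BG BD : ℝ) (ha : a < a') (hb : b' < b)
    (w W : ℝ × ℝ → ℝ) (G : ℝ → ℝ)
    (hGm : Measurable G) (hhc : Continuous h) (hWm : Measurable W)
    (hG : ∀ x, |G x| ≤ BG) (hD : ∀ x, |deriv G x| ≤ BD)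
    (hGg : ∀ x ∈ Ioo a' b', G x = g x) (hW : ∀ p, |W p| ≤ M)
    (hWw : ∀ᵐ p : ℝ × ℝ, p ∈ Ioo a' b' ×ˢ Ioo 0 T → w p = W p)
    (hE : InteriorEntropy g h a b T w) : Ent sgn G h (Ioo a' b' ×ˢ Ioo 0 T) W := by
  intro k φ hφ
  have hs := measurable_sgn
  have hdm : Measurable (deriv G) := measurable_deriv G
  have hhm : Measurable h := hhc.measurable
  obtain ⟨a1, a2, a3⟩ := test_fderiv_props φ hφ.1 hφ.2.1 (0, 1)
  obtain ⟨b1, b2, b3⟩ := test_fderiv_props φ hφ.1 hφ.2.1 (1, 0)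
  obtain ⟨Bh, hBh⟩ := (isCompact_Icc (a := -M) (b := M)).exists_bound_of_continuousOn
    (f := h) hhc.continuousOn
  have hBG : 0 ≤ BG := (abs_nonneg _).trans (hG 0)
  have hBD : 0 ≤ BD := (abs_nonneg _).trans (hD 0)
  have hdG : ∀ x ∈ Ioo a' b', deriv G x = deriv g x := by
    intro x hx
    apply EventuallyEq.deriv_eq
    filter_upwards [isOpen_Ioo.mem_nhds hx] with y hy using hGg y hy
  have key := hE k φ hφ.1 hφ.2.1 hφ.2.2.1
    (hφ.2.2.2.trans (prod_mono (Ioo_subset_Ioo ha.le hb.le) Subset.rfl))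
  set f : ℝ × ℝ → ℝ := fun p => (|w p - k| * fderiv ℝ φ p (0, 1)
      + sgn (w p - k) * (g p.1 * h (w p) - g p.1 * h k) * fderiv ℝ φ p (1, 0)
      - sgn (w p - k) * deriv g p.1 * h k * φ p) with hf
  set F : ℝ × ℝ → ℝ := fun p => (|W p - k| * fderiv ℝ φ p (0, 1)
      + sgn (W p - k) * (G p.1 * h (W p) - G p.1 * h k) * fderiv ℝ φ p (1, 0)
      - sgn (W p - k) * deriv G p.1 * h k * φ p) with hF
  have hFi : Integrable F := by
    refine Integrable.sub (Integrable.add ?_ ?_) ?_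
    · refine integrable_bdd_mul' (a1.integrable_of_hasCompactSupport a2) (by fun_prop) (M + |k|) ?_
      intro p
      rw [abs_abs]
      exact (abs_sub_le_add _ _).trans (add_le_add (hW p) le_rfl)
    · refine integrable_bdd_mul' (b1.integrable_of_hasCompactSupport b2) (by fun_prop)
        (BG * Bh + BG * |h k|) ?_
      intro p
      rw [abs_mul, abs_sgn, one_mul]
      exact (abs_sub_le_add _ _).trans
          (add_le_add (abs_mul_le_mul' (hG _) (hBh _ (abs_le.1 (hW p))))
            (abs_mul_le_mul' (hG _) le_rfl))
    · refine integrable_bdd_mul' (hφ.1.continuous.integrable_of_hasCompactSupport hφ.2.1)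
        (by fun_prop) (BD * |h k|) ?_
      intro p
      refine (abs_mul_le_mul' ?_ le_rfl)
      rw [abs_mul, abs_sgn, one_mul]
      exact hD _
  have hfz : ∀ p, p ∉ tsupport φ → f p = 0 := by
    intro p hp
    simp [hf, a3 p hp, b3 p hp, image_eq_zero_of_notMem_tsupport hp]
  have hFf : F =ᵐ[volume] f := by
    filter_upwards [hWw] with p hp
    by_cases hpt : p ∈ tsupport φ
    · have hpO := hφ.2.2.2 hpt
      simp only [hF, hf, hp hpO, hGg p.1 hpO.1, hdG p.1 hpO.1]
    · rw [hfz p hpt]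
      simp [hF, a3 p hpt, b3 p hpt, image_eq_zero_of_notMem_tsupport hpt]
  have hfi : Integrable f := hFi.congr hFf
  have e1 : ∫ p, F p = ∫ t, ∫ x, f (x, t) := by
    rw [integral_congr_ae hFf]
    rw [Measure.volume_eq_prod] at hfi ⊢
    exact integral_prod_symm _ hfi
  rw [e1]
  have hz : ∀ x t, (x, t) ∉ Ioo a b ×ˢ Ioo 0 T → f (x, t) = 0 := by
    intro x t hxt
    apply hfz
    intro hmem
    apply hxt
    have := hφ.2.2.2 hmem
    exact ⟨⟨ha.trans this.1.1, this.1.2.trans hb⟩, this.2⟩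
  have e2 : ∀ t, ∫ x in Ioo a b, f (x, t) = ∫ x, f (x, t) := fun t =>
    setIntegral_eq_integral_of_forall_compl_eq_zero fun x hx => hz x t fun hm => hx hm.1
  have e3 : ∫ t in Ioo 0 T, ∫ x, f (x, t) = ∫ t, ∫ x, f (x, t) :=
    setIntegral_eq_integral_of_forall_compl_eq_zero fun t ht => by
      have : ∀ x, f (x, t) = 0 := fun x => hz x t fun hm => ht hm.2
      simp [this]
  rw [← e3]
  simp_rw [← e2]
  exact key

end partSix

section partSeven
open Topology NNReal

lemma clamp_mem {a b : ℝ} (hab : a ≤ b) (x : ℝ) : max a (min b x) ∈ Icc a b :=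
  ⟨le_max_left _ _, max_le hab (min_le_left _ _)⟩

lemma clamp_eq {a b x : ℝ} (hx : x ∈ Icc a b) : max a (min b x) = x := by
  rw [min_eq_right hx.2, max_eq_right hx.1]

lemma clamp_lip (a b : ℝ) : LipschitzWith 1 (fun x : ℝ => max a (min b x)) :=
  (LipschitzWith.id.const_min b).const_max a

/-- Local boundedness together with the Kato inequality on a compact strip. -/
lemma kato_local (g h : ℝ → ℝ) (hg : LocallyLipschitz g) (hh : ContDiff ℝ 2 h)
    (hS' : deriv h 0 = 0) (hSC : StrictMono (deriv h))
    (a b T : ℝ)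
    (hgpos : ∀ x ∈ Ioo a b, 0 < g x)
    (u v : ℝ × ℝ → ℝ) (hum : Measurable u) (hvm : Measurable v) (C : ℝ)
    (hufb : ∀ᵐ p : ℝ × ℝ, p ∈ Ioo a b ×ˢ Ioo 0 T → |g p.1 * h (u p)| ≤ C)
    (hvfb : ∀ᵐ p : ℝ × ℝ, p ∈ Ioo a b ×ˢ Ioo 0 T → |g p.1 * h (v p)| ≤ C)
    (huent : InteriorEntropy g h a b T u) (hvent : InteriorEntropy g h a b T v)
    (a' b' : ℝ) (ha : a < a') (hb : b' < b) (hab' : a' < b') :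
    ∃ M : ℝ, 0 ≤ M ∧ (∀ᵐ p : ℝ × ℝ, p ∈ Icc a' b' ×ˢ Ioo 0 T → |u p| ≤ M ∧ |v p| ≤ M) ∧
      ∀ ψ, TestOK (Ioo a' b' ×ˢ Ioo 0 T) ψ →
      0 ≤ ∫ p, (|u p - v p| * fderiv ℝ ψ p (0, 1)
        + sgn (u p - v p) * (h (u p) - h (v p)) * g p.1 * fderiv ℝ ψ p (1, 0)) := by
  have hgc : Continuous g := hg.continuous
  have hsub : Icc a' b' ⊆ Ioo a b := fun x hx => ⟨ha.trans_le hx.1, hx.2.trans_lt hb⟩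
  obtain ⟨x0, hx0, hmin⟩ := (isCompact_Icc (a := a') (b := b')).exists_isMinOn
    (nonempty_Icc.2 hab'.le) hgc.continuousOn
  have hc : 0 < g x0 := hgpos _ (hsub hx0)
  obtain ⟨M, hM0, hM⟩ := h_coercive h hh hS' hSC (|C| / g x0) (by positivity)
  have bd : ∀ w : ℝ × ℝ → ℝ,
      (∀ᵐ p : ℝ × ℝ, p ∈ Ioo a b ×ˢ Ioo 0 T → |g p.1 * h (w p)| ≤ C) →
      ∀ᵐ p : ℝ × ℝ, p ∈ Icc a' b' ×ˢ Ioo 0 T → |w p| ≤ M := by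
    intro w hw
    filter_upwards [hw] with p hp hpm
    have h1 := hp ⟨hsub hpm.1, hpm.2⟩
    apply hM
    rw [le_div_iff₀ hc]
    have h2 : g x0 ≤ g p.1 := hmin hpm.1
    rw [abs_mul, abs_of_pos (hc.trans_le h2)] at h1
    have := abs_nonneg (h (w p))
    have := le_abs_self C
    nlinarith
  have bu := bd u hufb
  have bv := bd v hvfb
  refine ⟨M, hM0, ?_, ?_⟩
  · filter_upwards [bu, bv] with p h1 h2 hp using ⟨h1 hp, h2 hp⟩
  intro ψ hψ
  set G : ℝ → ℝ := fun x => g (max a' (min b' x)) with hGdef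
  obtain ⟨LG, hLG⟩ := (hg.locallyLipschitzOn (s := Icc a' b')).exists_lipschitzOnWith_of_compact
    isCompact_Icc
  have hGL : LipschitzWith LG G := by
    have := (hLG.comp (f := fun x : ℝ => max a' (min b' x)) (s := univ)
      ((clamp_lip a' b').lipschitzOnWith) (fun x _ => clamp_mem hab'.le x))
    rw [mul_one, lipschitzOnWith_univ] at this
    exact this
  obtain ⟨BG, hBG⟩ := (isCompact_Icc (a := a') (b := b')).exists_bound_of_continuousOn
    (f := g) hgc.continuousOn
  have hG : ∀ x, |G x| ≤ BG := fun x => hBG _ (clamp_mem hab'.le x)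
  have hD : ∀ x, |deriv G x| ≤ LG := fun x => norm_deriv_le_of_lipschitz hGL
  have hhc : Continuous h := hh.continuous
  obtain ⟨Bh, hBh⟩ := (isCompact_Icc (a := -M) (b := M)).exists_bound_of_continuousOn
    (f := h) hhc.continuousOn
  obtain ⟨Lh, hLh⟩ := ((hh.of_le one_le_two).locallyLipschitz.locallyLipschitzOn
    (s := Icc (-M) M)).exists_lipschitzOnWith_of_compact isCompact_Icc
  set U : ℝ × ℝ → ℝ := fun p => max (-M) (min M (u p)) with hUdef
  set V : ℝ × ℝ → ℝ := fun p => max (-M) (min M (v p)) with hVdef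
  have hMM : -M ≤ M := by linarith
  have hU : ∀ p, |U p| ≤ M := fun p => abs_le.2 (clamp_mem hMM _)
  have hV : ∀ p, |V p| ≤ M := fun p => abs_le.2 (clamp_mem hMM _)
  have hUm : Measurable U := measurable_const.max (measurable_const.min hum)
  have hVm : Measurable V := measurable_const.max (measurable_const.min hvm)
  have hGg : ∀ x ∈ Ioo a' b', G x = g x := fun x hx => by
    simp only [hGdef]; rw [clamp_eq (Ioo_subset_Icc_self hx)]
  have hUu : ∀ᵐ p : ℝ × ℝ, p ∈ Ioo a' b' ×ˢ Ioo 0 T → u p = U p := by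
    filter_upwards [bu] with p hp hpm
    exact (clamp_eq (abs_le.1 (hp ⟨Ioo_subset_Icc_self hpm.1, hpm.2⟩))).symm
  have hVv : ∀ᵐ p : ℝ × ℝ, p ∈ Ioo a' b' ×ˢ Ioo 0 T → v p = V p := by
    filter_upwards [bv] with p hp hpm
    exact (clamp_eq (abs_le.1 (hp ⟨Ioo_subset_Icc_self hpm.1, hpm.2⟩))).symm
  have hGm : Measurable G := hGL.continuous.measurable
  have eU := ent_of_interior g h a b T a' b' M BG LG ha hb u U G hGm hhc hUm hG hD hGg hU hUu huent
  have eV := ent_sgnm G h V BG LG M _ hGm hhc hVm hG hD hV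
    (ent_of_interior g h a b T a' b' M BG LG ha hb v V G hGm hhc hVm hG hD hGg hV hVv hvent)
  have := kato_abstract G h U V LG BG Bh Lh M Lh.2 hGL hG hhc.measurable hUm hVm
    (fun w hw => hBh w (abs_le.1 hw))
    (fun w w' hw hw' => by
      have := hLh.dist_le_mul w (abs_le.1 hw) w' (abs_le.1 hw')
      simpa [Real.dist_eq] using this) hU hV (Ioo a' b' ×ˢ Ioo 0 T)
    (isOpen_Ioo.prod isOpen_Ioo) eU eV ψ hψ
  refine this.trans_eq (integral_congr_ae ?_)
  obtain ⟨a1, a2, a3⟩ := test_fderiv_props ψ hψ.1 hψ.2.1 (0, 1)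
  obtain ⟨b1, b2, b3⟩ := test_fderiv_props ψ hψ.1 hψ.2.1 (1, 0)
  filter_upwards [hUu, hVv] with p h1 h2
  by_cases hp : p ∈ tsupport ψ
  · have hpO := hψ.2.2.2 hp
    rw [h1 hpO, h2 hpO, hGg p.1 hpO.1]
  · simp only [a3 p hp, b3 p hp, mul_zero]

/-! Monotonicity of `h`. -/

lemma h_mono_anti (h : ℝ → ℝ) (hh : ContDiff ℝ 2 h) (hS' : deriv h 0 = 0)
    (hSC : StrictMono (deriv h)) : MonotoneOn h (Ici 0) ∧ AntitoneOn h (Iic 0) := by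
  have hd : Differentiable ℝ h := hh.differentiable (by simp)
  constructor
  · apply monotoneOn_of_deriv_nonneg (convex_Ici 0) hd.continuous.continuousOn hd.differentiableOn
    intro x hx
    rw [interior_Ici] at hx
    rw [← hS']; exact hSC.monotone (le_of_lt hx)
  · apply antitoneOn_of_deriv_nonpos (convex_Iic 0) hd.continuous.continuousOn hd.differentiableOn
    intro x hx
    rw [interior_Iic] at hx
    rw [← hS']; exact hSC.monotone (le_of_lt hx)

lemma flux_upper (h : ℝ → ℝ) (hS : h 0 = 0) (hm : MonotoneOn h (Ici 0)) (hA : AntitoneOn h (Iic 0))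
    (R x y : ℝ) (hR : 0 < R) (hx : x ≤ R) (hy : y ≤ R) :
    sgn (x - y) * (h x - h y) ≤ h R := by
  have nn : ∀ z, 0 ≤ h z := fun z => by
    rcases le_total 0 z with hz | hz
    · rw [← hS]; exact hm (mem_Ici.2 le_rfl) hz hz
    · rw [← hS]; exact hA hz (mem_Iic.2 le_rfl) hz
  have key : ∀ s t, s ≤ R → t ≤ s → h s - h t ≤ h R := by
    intro s t hs hts
    rcases le_total 0 s with hz | hz
    · have := hm hz (hz.trans hs) hs
      linarith [nn t]
    · have := hA (hts.trans hz) hz hts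
      linarith [nn R]
  unfold sgn
  split_ifs with hc
  · linarith [key x y hx (by linarith)]
  · linarith [key y x hy (by linarith)]

lemma flux_lower (h : ℝ → ℝ) (hS : h 0 = 0) (hm : MonotoneOn h (Ici 0)) (hA : AntitoneOn h (Iic 0))
    (R x y : ℝ) (hR : 0 < R) (hx : -R ≤ x) (hy : -R ≤ y) :
    - h (-R) ≤ sgn (x - y) * (h x - h y) := by
  have nn : ∀ z, 0 ≤ h z := fun z => by
    rcases le_total 0 z with hz | hz
    · rw [← hS]; exact hm (mem_Ici.2 le_rfl) hz hz
    · rw [← hS]; exact hA hz (mem_Iic.2 le_rfl) hz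
  have key : ∀ s t, -R ≤ t → t ≤ s → h t - h s ≤ h (-R) := by
    intro s t hs hts
    rcases le_total 0 t with hz | hz
    · have := hm hz (hz.trans hts) hts
      linarith [nn (-R)]
    · have := hA (mem_Iic.2 (by linarith)) hz hs
      linarith [nn s]
  unfold sgn
  split_ifs with hc
  · linarith [key x y hy (by linarith)]
  · linarith [key y x hx (by linarith)]

end partSeven

section partEight
open Topology NNReal

lemma time_lemma (m e : ℝ → ℝ) (T : ℝ) (hm : Integrable m) (he : Integrable e) (he0 : ∀ t, 0 ≤ e t)
    (H : ∀ θ : ℝ → ℝ, ContDiff ℝ (⊤ : ℕ∞) θ → HasCompactSupport θ → (∀ t, 0 ≤ θ t) →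
      tsupport θ ⊆ Ioo 0 T → 0 ≤ (∫ t, m t * deriv θ t) + ∫ t, e t * θ t) :
    ∃ S : Set ℝ, (∀ᵐ t : ℝ, t ∈ S) ∧ ∀ σ ∈ S, ∀ τ ∈ S, 0 < σ → σ < τ → τ < T →
      m τ ≤ m σ + ∫ t, e t := by
  let φ : ℕ → ContDiffBump (0 : ℝ) := fun i =>
    { rIn := 1 / ((i : ℝ) + 1)
      rOut := 2 / ((i : ℝ) + 1)
      rIn_pos := by positivity
      rIn_lt_rOut := by
        have : (0 : ℝ) < (i : ℝ) + 1 := by positivity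
        exact div_lt_div_of_pos_right (by norm_num) this }
  have hr : Tendsto (fun i => (φ i).rOut) atTop (𝓝 0) := by
    have := (tendsto_one_div_add_atTop_nhds_zero_nat (𝕜 := ℝ)).const_mul 2
    rw [mul_zero] at this
    refine this.congr fun i => ?_
    change 2 * (1 / ((i : ℝ) + 1)) = 2 / ((i : ℝ) + 1)
    ring
  have hK : ∀ᶠ i in atTop, (φ i).rOut ≤ 2 * (φ i).rIn := Eventually.of_forall fun i => by
    change 2 / ((i : ℝ) + 1) ≤ 2 * (1 / ((i : ℝ) + 1))
    apply le_of_eq; ring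
  have hae := ContDiffBump.ae_convolution_tendsto_right_of_locallyIntegrable (μ := volume)
    hr hK hm.locallyIntegrable
  refine ⟨{s | Tendsto (fun i => MeasureTheory.convolution ((φ i).normed volume) m
    (ContinuousLinearMap.lsmul ℝ ℝ) volume s) atTop (𝓝 (m s))}, hae, ?_⟩
  intro σ hσ τ hτ h0 hst hT
  rw [mem_ofPred_eq] at hσ hτ
  have lim := (hσ.sub hτ).add_const (∫ t, e t)
  suffices h : 0 ≤ m σ - m τ + ∫ t, e t by linarith
  refine ge_of_tendsto lim ?_
  have hsmall : ∀ᶠ i in atTop, (φ i).rOut < min σ (T - τ) :=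
    hr.eventually (gt_mem_nhds (lt_min h0 (by linarith)))
  filter_upwards [hsmall] with i hi
  have hi1 : (φ i).rOut < σ := hi.trans_le (min_le_left _ _)
  have hi2 : (φ i).rOut < T - τ := hi.trans_le (min_le_right _ _)
  set ρ : ℝ → ℝ := (φ i).normed volume with hρ
  have hρc : ContDiff ℝ (⊤ : ℕ∞) ρ := (φ i).contDiff_normed
  have hρcont : Continuous ρ := hρc.continuous
  have hρ0 : ∀ t, 0 ≤ ρ t := (φ i).nonneg_normed
  have hρint : ∫ t, ρ t = 1 := (φ i).integral_normed
  have hρi : Integrable ρ := (φ i).integrable_normed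
  have hρz : ∀ t, (φ i).rOut ≤ |t| → ρ t = 0 := by
    intro t ht
    have : t ∉ Function.support ρ := by
      rw [hρ, (φ i).support_normed_eq]
      simpa using ht
    simpa using this
  set θ : ℝ → ℝ := fun t => ∫ r in (t - τ)..(t - σ), ρ r with hθ
  have hθd : ∀ t, HasDerivAt θ (ρ (t - σ) - ρ (t - τ)) t := by
    intro t
    have d0 : ∀ s, HasDerivAt (fun x => ∫ r in (0 : ℝ)..x, ρ r) (ρ s) s := fun s =>
      intervalIntegral.integral_hasDerivAt_right (hρcont.intervalIntegrable _ _)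
        (hρcont.stronglyMeasurableAtFilter _ _) hρcont.continuousAt
    have d1 := (d0 (t - σ)).comp_sub_const t σ
    have d2 := (d0 (t - τ)).comp_sub_const t τ
    refine (d1.sub d2).congr_of_eventuallyEq ?_
    filter_upwards with x
    simp only [hθ, Pi.sub_apply]
    rw [intervalIntegral.integral_interval_sub_left (hρcont.intervalIntegrable _ _)
      (hρcont.intervalIntegrable _ _)]
  have hθderiv : deriv θ = fun t => ρ (t - σ) - ρ (t - τ) := funext fun t => (hθd t).deriv
  have hθsm : ContDiff ℝ (⊤ : ℕ∞) θ := by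
    rw [contDiff_infty_iff_deriv]
    refine ⟨fun t => (hθd t).differentiableAt, ?_⟩
    rw [hθderiv]
    exact (hρc.comp (contDiff_id.sub contDiff_const)).sub
      (hρc.comp (contDiff_id.sub contDiff_const))
  have hle : ∀ t, t - τ ≤ t - σ := fun t => by linarith
  have hθ0 : ∀ t, 0 ≤ θ t := fun t =>
    intervalIntegral.integral_nonneg (hle t) fun r _ => hρ0 r
  have hθ1 : ∀ t, θ t ≤ 1 := fun t => by
    simp only [hθ]
    rw [intervalIntegral.integral_of_le (hle t), ← hρint]
    exact setIntegral_le_integral hρi (Eventually.of_forall hρ0)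
  have hsup : Function.support θ ⊆ Icc (σ - (φ i).rOut) (τ + (φ i).rOut) := by
    intro t ht
    by_contra hcon
    apply ht
    simp only [hθ]
    rw [intervalIntegral.integral_of_le (hle t)]
    apply setIntegral_eq_zero_of_forall_eq_zero
    intro r hr'
    apply hρz
    rw [mem_Icc, not_and_or] at hcon
    rcases hcon with hcon | hcon
    · push Not at hcon
      have := neg_le_abs r
      have := hr'.2
      linarith
    · push Not at hcon
      have := le_abs_self r
      have := hr'.1
      linarith
  have hts : tsupport θ ⊆ Icc (σ - (φ i).rOut) (τ + (φ i).rOut) :=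
    closure_minimal hsup isClosed_Icc
  have hcs : HasCompactSupport θ := isCompact_Icc.of_isClosed_subset (isClosed_tsupport _) hts
  have main := H θ hθsm hcs hθ0 (hts.trans fun t ht => ⟨by linarith [ht.1], by linarith [ht.2]⟩)
  have conv : ∀ s, MeasureTheory.convolution ρ m (ContinuousLinearMap.lsmul ℝ ℝ) volume s
      = ∫ t, m t * ρ (t - s) := by
    intro s
    rw [convolution_eq_swap]
    refine integral_congr_ae (Eventually.of_forall fun t => ?_)
    simp only [ContinuousLinearMap.lsmul_apply, smul_eq_mul]
    rw [← neg_sub t s, hρ, (φ i).normed_neg, mul_comm]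
  have hρb : ∃ B, ∀ t, ‖ρ t‖ ≤ B :=
    hρcont.bounded_above_of_compact_support (φ i).hasCompactSupport_normed
  obtain ⟨B, hB⟩ := hρb
  have hmi : ∀ s, Integrable (fun t => m t * ρ (t - s)) := fun s =>
    hm.mul_bdd (c := B) (hρcont.comp (continuous_id.sub continuous_const)).aestronglyMeasurable
      (Eventually.of_forall fun t => hB _)
  have e1 : ∫ t, m t * deriv θ t = (∫ t, m t * ρ (t - σ)) - ∫ t, m t * ρ (t - τ) := by
    rw [← integral_sub (hmi σ) (hmi τ), hθderiv]
    simp only [mul_sub]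
  have e2 : ∫ t, e t * θ t ≤ ∫ t, e t := by
    refine integral_mono (he.mul_bdd (c := 1) hθsm.continuous.aestronglyMeasurable
      (Eventually.of_forall fun t => ?_)) he fun t => ?_
    · rw [Real.norm_eq_abs, abs_of_nonneg (hθ0 t)]; exact hθ1 t
    · exact mul_le_of_le_one_right (he0 t) (hθ1 t)
  rw [conv, conv, ← e1]
  linarith

/-! Cutoff functions. -/

lemma exists_smooth_step : ∃ K : ℝ, 0 ≤ K ∧ ∀ x, 0 ≤ deriv Real.smoothTransition x ∧
    deriv Real.smoothTransition x ≤ K ∧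
    (x ∉ Icc (0 : ℝ) 1 → deriv Real.smoothTransition x = 0) := by
  have hc : Continuous (deriv Real.smoothTransition) :=
    (Real.smoothTransition.contDiff (n := 1)).continuous_deriv (by simp)
  obtain ⟨K, hK⟩ := (isCompact_Icc (a := (0 : ℝ)) (b := 1)).exists_bound_of_continuousOn
    hc.continuousOn
  have hz : ∀ x, x ∉ Icc (0 : ℝ) 1 → deriv Real.smoothTransition x = 0 := by
    intro x hx
    rw [mem_Icc, not_and_or] at hx
    rcases hx with hx | hx
    · push Not at hx
      have : Real.smoothTransition =ᶠ[𝓝 x] fun _ => 0 := by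
        filter_upwards [gt_mem_nhds hx] with y hy
        exact Real.smoothTransition.zero_of_nonpos (le_of_lt hy)
      rw [this.deriv_eq]; simp
    · push Not at hx
      have : Real.smoothTransition =ᶠ[𝓝 x] fun _ => 1 := by
        filter_upwards [lt_mem_nhds hx] with y hy
        exact Real.smoothTransition.one_of_one_le (le_of_lt hy)
      rw [this.deriv_eq]; simp
  have hK0 : 0 ≤ K := (norm_nonneg _).trans (hK 0 (by simp))
  refine ⟨K, hK0, fun x => ⟨Real.smoothTransition.monotone.deriv_nonneg, ?_, hz x⟩⟩
  by_cases hx : x ∈ Icc (0 : ℝ) 1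
  · exact (le_abs_self _).trans (hK x hx)
  · rw [hz x hx]; exact hK0

lemma exists_cutoff : ∃ K : ℝ, 0 ≤ K ∧ ∀ a b δ : ℝ, 0 < δ →
    ∃ χ p q : ℝ → ℝ, ContDiff ℝ (⊤ : ℕ∞) χ ∧ (∀ x, 0 ≤ χ x ∧ χ x ≤ 1) ∧
      (∀ x, x ∉ Icc (a + δ) (b - δ) → χ x = 0) ∧
      (∀ x ∈ Icc (a + 2 * δ) (b - 2 * δ), χ x = 1) ∧
      (∀ x, deriv χ x = p x - q x) ∧ Measurable p ∧ Measurable q ∧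
      (∀ x, 0 ≤ p x ∧ p x ≤ K / δ ∧ (x ∉ Icc (a + δ) (a + 2 * δ) → p x = 0)) ∧
      (∀ x, 0 ≤ q x ∧ q x ≤ K / δ ∧ (x ∉ Icc (b - 2 * δ) (b - δ) → q x = 0)) ∧
      (∀ x, x ∉ Icc (a + δ) (b - δ) → p x = 0 ∧ q x = 0) := by
  obtain ⟨K, hK0, hK⟩ := exists_smooth_step
  refine ⟨K, hK0, fun a b δ hδ => ?_⟩
  set S := Real.smoothTransition with hS
  have hSc : ContDiff ℝ (⊤ : ℕ∞) S := Real.smoothTransition.contDiff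
  have hSd : Differentiable ℝ S := hSc.differentiable (by simp)
  have hdm : Measurable (deriv S) := measurable_deriv S
  have hSm : Measurable S := hSc.continuous.measurable
  have n0 : ∀ x, 0 ≤ S x := Real.smoothTransition.nonneg
  have n1 : ∀ x, S x ≤ 1 := Real.smoothTransition.le_one
  have z0 : ∀ x, x ≤ 0 → S x = 0 := fun x => Real.smoothTransition.zero_of_nonpos
  refine ⟨fun x => S ((x - a) / δ - 1) * S ((b - x) / δ - 1),
    fun x => deriv S ((x - a) / δ - 1) * δ⁻¹ * S ((b - x) / δ - 1),
    fun x => S ((x - a) / δ - 1) * (deriv S ((b - x) / δ - 1) * δ⁻¹),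
    ?_, ?_, ?_, ?_, ?_, by fun_prop, by fun_prop, ?_, ?_, ?_⟩
  · fun_prop
  · intro x
    exact ⟨mul_nonneg (n0 _) (n0 _), mul_le_one₀ (n1 _) (n0 _) (n1 _)⟩
  · intro x hx
    rw [mem_Icc, not_and_or] at hx
    beta_reduce
    rcases hx with hx | hx
    · rw [z0 ((x - a) / δ - 1) (by rw [sub_nonpos, div_le_one hδ]; linarith), zero_mul]
    · rw [z0 ((b - x) / δ - 1) (by rw [sub_nonpos, div_le_one hδ]; linarith), mul_zero]
  · intro x hx
    have h1 : 1 ≤ (x - a) / δ - 1 := by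
      rw [le_sub_iff_add_le, le_div_iff₀ hδ]; linarith [hx.1]
    have h2 : 1 ≤ (b - x) / δ - 1 := by
      rw [le_sub_iff_add_le, le_div_iff₀ hδ]; linarith [hx.2]
    simp only [hS]
    rw [Real.smoothTransition.one_of_one_le h1, Real.smoothTransition.one_of_one_le h2, one_mul]
  · intro x
    have i1 : HasDerivAt (fun x => (x - a) / δ - 1) (δ⁻¹) x := by
      have := (((hasDerivAt_id x).sub_const a).div_const δ).sub_const 1
      simpa using this
    have i2 : HasDerivAt (fun x => (b - x) / δ - 1) (-δ⁻¹) x := by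
      have := (((hasDerivAt_id x).const_sub b).div_const δ).sub_const 1
      simpa [neg_div] using this
    have d1 := (hSd ((x - a) / δ - 1)).hasDerivAt.comp x i1
    have d2 := (hSd ((b - x) / δ - 1)).hasDerivAt.comp x i2
    have := (d1.mul d2).deriv
    simp only [Function.comp_def] at this
    refine Eq.trans ?_ (this.trans ?_)
    · rfl
    · ring
  · intro x
    obtain ⟨k1, k2, k3⟩ := hK ((x - a) / δ - 1)
    have hδ' : 0 ≤ δ⁻¹ := inv_nonneg.2 hδ.le
    refine ⟨by have := n0 ((b - x) / δ - 1); positivity, ?_, ?_⟩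
    · rw [div_eq_mul_inv]
      beta_reduce
      calc _ ≤ deriv S ((x - a) / δ - 1) * δ⁻¹ * 1 := by
            gcongr; exact n1 _
        _ ≤ _ := by rw [mul_one]; gcongr
    · intro hx
      beta_reduce
      rw [k3, zero_mul, zero_mul]
      intro hx'
      apply hx
      have h1 := hx'.1
      have h2 := hx'.2
      rw [sub_nonneg, le_div_iff₀ hδ] at h1
      rw [sub_le_iff_le_add, div_le_iff₀ hδ] at h2
      constructor <;> linarith
  · intro x
    obtain ⟨k1, k2, k3⟩ := hK ((b - x) / δ - 1)
    have hδ' : 0 ≤ δ⁻¹ := inv_nonneg.2 hδ.le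
    refine ⟨by have := n0 ((x - a) / δ - 1); positivity, ?_, ?_⟩
    · rw [div_eq_mul_inv]
      beta_reduce
      calc _ ≤ 1 * (deriv S ((b - x) / δ - 1) * δ⁻¹) := by
            gcongr; exact n1 _
        _ ≤ _ := by rw [one_mul]; gcongr
    · intro hx
      beta_reduce
      rw [k3, zero_mul, mul_zero]
      intro hx'
      apply hx
      have h1 := hx'.1
      have h2 := hx'.2
      rw [sub_nonneg, le_div_iff₀ hδ] at h1
      rw [sub_le_iff_le_add, div_le_iff₀ hδ] at h2
      constructor <;> linarith
  · intro x hx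
    rw [mem_Icc, not_and_or] at hx
    rcases hx with hx | hx
    · have h1 : (x - a) / δ - 1 < 0 := by rw [sub_neg, div_lt_one hδ]; linarith
      have h2 := (hK ((x - a) / δ - 1)).2.2 (fun h => by linarith [h.1])
      simp only
      rw [h2, z0 _ h1.le]; simp
    · have h1 : (b - x) / δ - 1 < 0 := by rw [sub_neg, div_lt_one hδ]; linarith
      have h2 := (hK ((b - x) / δ - 1)).2.2 (fun h => by linarith [h.1])
      simp only
      rw [h2, z0 _ h1.le]; simp

end partEight

section partNine
open Topology NNReal

lemma integrable_ind_bdd (O : Set (ℝ × ℝ)) (hO : MeasurableSet O) (hfin : volume O < ⊤)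
    (f : ℝ × ℝ → ℝ) (hf : Measurable f) (B : ℝ) (hB : ∀ᵐ p : ℝ × ℝ, p ∈ O → |f p| ≤ B) :
    Integrable (O.indicator f) := by
  rw [integrable_indicator_iff hO]
  refine Measure.integrableOn_of_bounded (M := B) hfin.ne hf.aestronglyMeasurable ?_
  rw [ae_restrict_iff' hO]
  exact hB

lemma tensor_fderiv (χ θ : ℝ → ℝ) (hχ : Differentiable ℝ χ) (hθ : Differentiable ℝ θ)
    (p : ℝ × ℝ) :
    fderiv ℝ (fun p : ℝ × ℝ => χ p.1 * θ p.2) p (0, 1) = χ p.1 * deriv θ p.2 ∧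
    fderiv ℝ (fun p : ℝ × ℝ => χ p.1 * θ p.2) p (1, 0) = deriv χ p.1 * θ p.2 := by
  have h1 : HasFDerivAt (fun p : ℝ × ℝ => χ p.1) _ p :=
    (hχ p.1).hasDerivAt.hasFDerivAt.comp p hasFDerivAt_fst
  have h2 : HasFDerivAt (fun p : ℝ × ℝ => θ p.2) _ p :=
    (hθ p.2).hasDerivAt.hasFDerivAt.comp p hasFDerivAt_snd
  have h3 : fderiv ℝ (fun p : ℝ × ℝ => χ p.1 * θ p.2) p = _ := (h1.mul h2).fderiv
  rw [h3]
  constructor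
  · simp
  · simp [mul_comm]

lemma tensor_test (χ θ : ℝ → ℝ) (a' b' c d T : ℝ) (hχ : ContDiff ℝ (⊤ : ℕ∞) χ)
    (hθ : ContDiff ℝ (⊤ : ℕ∞) θ) (hχ0 : ∀ x, 0 ≤ χ x) (hθ0 : ∀ t, 0 ≤ θ t)
    (hχs : ∀ x, x ∉ Icc c d → χ x = 0) (hθc : HasCompactSupport θ) (hθs : tsupport θ ⊆ Ioo 0 T)
    (hac : a' < c) (hdb : d < b') :
    TestOK (Ioo a' b' ×ˢ Ioo 0 T) (fun p : ℝ × ℝ => χ p.1 * θ p.2) := by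
  have hsup : tsupport (fun p : ℝ × ℝ => χ p.1 * θ p.2) ⊆ Icc c d ×ˢ tsupport θ := by
    refine closure_minimal ?_ (isClosed_Icc.prod (isClosed_tsupport θ))
    intro p hp
    constructor
    · by_contra hc
      apply hp
      simp [hχs p.1 hc]
    · by_contra hc
      apply hp
      simp [image_eq_zero_of_notMem_tsupport hc]
  refine ⟨(hχ.comp contDiff_fst).mul (hθ.comp contDiff_snd), ?_,
    fun p => mul_nonneg (hχ0 _) (hθ0 _), hsup.trans ?_⟩
  · exact (isCompact_Icc.prod hθc).of_isClosed_subset (isClosed_tsupport _) hsup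
  · exact prod_mono (fun x hx => ⟨hac.trans_le hx.1, hx.2.trans_lt hdb⟩) hθs

lemma strip (D F : ℝ × ℝ → ℝ) (hDm : Measurable D) (hFm : Measurable F) (a' b' c d T : ℝ)
    (hac : a' < c) (hdb : d < b')
    (BD BF B : ℝ)
    (hD : ∀ᵐ p : ℝ × ℝ, p ∈ Icc c d ×ˢ Ioo 0 T → |D p| ≤ BD)
    (hF : ∀ᵐ p : ℝ × ℝ, p ∈ Icc c d ×ˢ Ioo 0 T → |F p| ≤ BF)
    (hK : ∀ ψ, TestOK (Ioo a' b' ×ˢ Ioo 0 T) ψ →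
      0 ≤ ∫ p, (D p * fderiv ℝ ψ p (0, 1) + F p * fderiv ℝ ψ p (1, 0)))
    (χ P Q : ℝ → ℝ) (hχ : ContDiff ℝ (⊤ : ℕ∞) χ) (hχ1 : ∀ x, 0 ≤ χ x ∧ χ x ≤ 1)
    (hχs : ∀ x, x ∉ Icc c d → χ x = 0)
    (hχd : ∀ x, deriv χ x = P x - Q x) (hPm : Measurable P) (hQm : Measurable Q)
    (hP : ∀ x, 0 ≤ P x ∧ P x ≤ B) (hQ : ∀ x, 0 ≤ Q x ∧ Q x ≤ B)
    (hPQ : ∀ x, x ∉ Icc c d → P x = 0 ∧ Q x = 0) :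
    Integrable (fun t => (Ioo 0 T).indicator
        (fun t => ∫ x, (P x * max (F (x, t)) 0 + Q x * max (-F (x, t)) 0)) t) ∧
    ∃ S : Set ℝ, (∀ᵐ t : ℝ, t ∈ S) ∧ ∀ σ ∈ S, ∀ τ ∈ S, 0 < σ → σ < τ → τ < T →
      ∫ x, D (x, τ) * χ x ≤ (∫ x, D (x, σ) * χ x) +
        ∫ t, (Ioo 0 T).indicator
          (fun t => ∫ x, (P x * max (F (x, t)) 0 + Q x * max (-F (x, t)) 0)) t := by
  set O : Set (ℝ × ℝ) := Icc c d ×ˢ Ioo 0 T with hOdef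
  have hO : MeasurableSet O := measurableSet_Icc.prod measurableSet_Ioo
  have hfin : volume O < ⊤ := by
    rw [hOdef, Measure.volume_eq_prod, Measure.prod_prod]
    exact ENNReal.mul_lt_top measure_Icc_lt_top measure_Ioo_lt_top
  have hB0 : 0 ≤ B := (hP 0).1.trans (hP 0).2
  have hχm : Measurable χ := hχ.continuous.measurable
  set D1 : ℝ × ℝ → ℝ := O.indicator (fun p => D p * χ p.1) with hD1
  set E1 : ℝ × ℝ → ℝ := O.indicator
    (fun p => P p.1 * max (F p) 0 + Q p.1 * max (-F p) 0) with hE1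
  set F1 : ℝ × ℝ → ℝ := O.indicator (fun p => F p * (P p.1 - Q p.1)) with hF1
  have iD : Integrable D1 := by
    refine integrable_ind_bdd O hO hfin _ (by fun_prop) (BD * 1) ?_
    filter_upwards [hD] with p hp hpO
    refine abs_mul_le_mul' (hp hpO) ?_
    rw [abs_of_nonneg (hχ1 _).1]; exact (hχ1 _).2
  have iE : Integrable E1 := by
    refine integrable_ind_bdd O hO hfin _ (by fun_prop) (B * BF + B * BF) ?_
    filter_upwards [hF] with p hp hpO
    have h1 := hp hpO
    have h2 := (abs_nonneg _).trans h1
    refine (abs_add_le _ _).trans (add_le_add (abs_mul_le_mul' ?_ ?_) (abs_mul_le_mul' ?_ ?_))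
    · rw [abs_of_nonneg (hP _).1]; exact (hP _).2
    · rw [abs_of_nonneg (le_max_right _ _)]; exact max_le ((le_abs_self _).trans h1) h2
    · rw [abs_of_nonneg (hQ _).1]; exact (hQ _).2
    · rw [abs_of_nonneg (le_max_right _ _)]; exact max_le ((neg_le_abs _).trans h1) h2
  have iF : Integrable F1 := by
    refine integrable_ind_bdd O hO hfin _ (by fun_prop) (BF * (B + B)) ?_
    filter_upwards [hF] with p hp hpO
    refine abs_mul_le_mul' (hp hpO) ((abs_sub_le_add _ _).trans (add_le_add ?_ ?_))
    · rw [abs_of_nonneg (hP _).1]; exact (hP _).2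
    · rw [abs_of_nonneg (hQ _).1]; exact (hQ _).2
  have E1nn : ∀ p, 0 ≤ E1 p := fun p => by
    refine indicator_nonneg (fun p _ => ?_) p
    exact add_nonneg (mul_nonneg (hP _).1 (le_max_right _ _))
      (mul_nonneg (hQ _).1 (le_max_right _ _))
  set m : ℝ → ℝ := fun t => ∫ x, D1 (x, t) with hm
  set e : ℝ → ℝ := fun t => ∫ x, E1 (x, t) with he
  have im : Integrable m := by
    rw [Measure.volume_eq_prod] at iD
    exact iD.integral_prod_right
  have ie : Integrable e := by
    rw [Measure.volume_eq_prod] at iE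
    exact iE.integral_prod_right
  have me : ∀ t ∈ Ioo 0 T, m t = ∫ x, D (x, t) * χ x := by
    intro t ht
    refine integral_congr_ae (Eventually.of_forall fun x => ?_)
    by_cases hx : x ∈ Icc c d
    · simp only [hD1]
      rw [indicator_of_mem (show (x, t) ∈ O from ⟨hx, ht⟩)]
    · simp only [hD1]
      rw [indicator_of_notMem (fun h => hx h.1), hχs x hx, mul_zero]
  have ee : e = fun t => (Ioo 0 T).indicator
        (fun t => ∫ x, (P x * max (F (x, t)) 0 + Q x * max (-F (x, t)) 0)) t := by
    funext t
    by_cases ht : t ∈ Ioo 0 T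
    · rw [indicator_of_mem ht]
      refine integral_congr_ae (Eventually.of_forall fun x => ?_)
      by_cases hx : x ∈ Icc c d
      · simp only [hE1]
        rw [indicator_of_mem (show (x, t) ∈ O from ⟨hx, ht⟩)]
      · simp only [hE1]
        rw [indicator_of_notMem (fun h => hx h.1), (hPQ x hx).1, (hPQ x hx).2]
        simp
    · rw [indicator_of_notMem ht]
      have : ∀ x, E1 (x, t) = 0 := fun x => indicator_of_notMem (fun h => ht h.2) _
      simp [he, this]
  rw [← ee]
  refine ⟨ie, ?_⟩
  have tl := time_lemma m e T im ie (fun t => integral_nonneg fun x => E1nn _) ?_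
  · obtain ⟨S, hS, hS2⟩ := tl
    refine ⟨S, hS, fun σ hσ τ hτ h0 h1 h2 => ?_⟩
    have := hS2 σ hσ τ hτ h0 h1 h2
    rwa [me τ ⟨h0.trans h1, h2⟩, me σ ⟨h0, h1.trans h2⟩] at this
  intro θ hθ hθc hθ0 hθs
  have hχdiff : Differentiable ℝ χ := hχ.differentiable (by simp)
  have hθdiff : Differentiable ℝ θ := hθ.differentiable (by simp)
  have k0 := hK _ (tensor_test χ θ a' b' c d T hχ hθ (fun x => (hχ1 x).1) hθ0 hχs hθc hθs hac hdb)
  simp_rw [(tensor_fderiv χ θ hχdiff hθdiff _).1, (tensor_fderiv χ θ hχdiff hθdiff _).2] at k0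
  have hθ'c : Continuous (deriv θ) := hθ.continuous_deriv (by simp)
  obtain ⟨B1, hB1⟩ := hθ.continuous.bounded_above_of_compact_support hθc
  obtain ⟨B2, hB2⟩ := hθ'c.bounded_above_of_compact_support hθc.deriv
  have iDθ : Integrable (fun p => D1 p * deriv θ p.2) :=
    iD.mul_bdd (c := B2) (hθ'c.comp continuous_snd).aestronglyMeasurable
      (Eventually.of_forall fun p => hB2 _)
  have iEθ : Integrable (fun p => E1 p * θ p.2) :=
    iE.mul_bdd (c := B1) (hθ.continuous.comp continuous_snd).aestronglyMeasurable
      (Eventually.of_forall fun p => hB1 _)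
  have iFθ : Integrable (fun p => F1 p * θ p.2) :=
    iF.mul_bdd (c := B1) (hθ.continuous.comp continuous_snd).aestronglyMeasurable
      (Eventually.of_forall fun p => hB1 _)
  have zθ : ∀ t, t ∉ Ioo 0 T → θ t = 0 ∧ deriv θ t = 0 := by
    intro t ht
    have h1 : t ∉ tsupport θ := fun h => ht (hθs h)
    exact ⟨image_eq_zero_of_notMem_tsupport h1,
      Function.notMem_support.1 fun h => h1 (support_deriv_subset h)⟩
  have k1 : ∀ p : ℝ × ℝ, D p * (χ p.1 * deriv θ p.2) + F p * (deriv χ p.1 * θ p.2)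
      = D1 p * deriv θ p.2 + F1 p * θ p.2 := by
    intro p
    by_cases hp : p ∈ O
    · simp only [hD1, hF1, indicator_of_mem hp, hχd]; ring
    · simp only [hD1, hF1, indicator_of_notMem hp, hχd]
      by_cases hx : p.1 ∈ Icc c d
      · have ht : p.2 ∉ Ioo 0 T := fun h => hp ⟨hx, h⟩
        rw [(zθ _ ht).1, (zθ _ ht).2]; ring
      · rw [(hPQ _ hx).1, (hPQ _ hx).2, hχs _ hx]; ring
  have k2 : ∀ p : ℝ × ℝ, F1 p * θ p.2 ≤ E1 p * θ p.2 := by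
    intro p
    refine mul_le_mul_of_nonneg_right ?_ (hθ0 _)
    refine indicator_le_indicator ?_
    have h1 := mul_le_mul_of_nonneg_left (le_max_left (F p) 0) (hP p.1).1
    have h2 := mul_le_mul_of_nonneg_left (le_max_left (-F p) 0) (hQ p.1).1
    linarith
  simp_rw [k1] at k0
  have k3 : 0 ≤ (∫ p, D1 p * deriv θ p.2) + ∫ p, E1 p * θ p.2 := by
    rw [← integral_add iDθ iEθ]
    refine k0.trans (integral_mono (iDθ.add iFθ) (iDθ.add iEθ) fun p => ?_)
    exact add_le_add le_rfl (k2 p)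
  have f1 : ∫ p, D1 p * deriv θ p.2 = ∫ t, m t * deriv θ t := by
    rw [Measure.volume_eq_prod] at iDθ ⊢
    rw [integral_prod_symm _ iDθ]
    simp only [hm, integral_mul_const]
  have f2 : ∫ p, E1 p * θ p.2 = ∫ t, e t * θ t := by
    rw [Measure.volume_eq_prod] at iEθ ⊢
    rw [integral_prod_symm _ iEθ]
    simp only [he, integral_mul_const]
  rw [← f1, ← f2]
  exact k3

end partNine

section partTen
open Topology NNReal

lemma ae_slice {p : ℝ × ℝ → Prop} (h : ∀ᵐ z : ℝ × ℝ, p z) : ∀ᵐ t : ℝ, ∀ᵐ x : ℝ, p (x, t) := by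
  rw [Measure.volume_eq_prod] at h
  have h2 : ∀ᵐ z : ℝ × ℝ ∂((volume : Measure ℝ).prod (volume : Measure ℝ)), p z.swap :=
    (Measure.measurePreserving_swap (μ := (volume : Measure ℝ))
      (ν := (volume : Measure ℝ))).quasiMeasurePreserving.ae h
  exact Measure.ae_ae_of_ae_prod h2

lemma edge_bound (a b δ K ε : ℝ) (hδ : 0 < δ) (hK : 0 ≤ K) (hε : 0 ≤ ε) (P Q f : ℝ → ℝ)
    (hP : ∀ x, 0 ≤ P x ∧ P x ≤ K / δ ∧ (x ∉ Icc (a + δ) (a + 2 * δ) → P x = 0))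
    (hQ : ∀ x, 0 ≤ Q x ∧ Q x ≤ K / δ ∧ (x ∉ Icc (b - 2 * δ) (b - δ) → Q x = 0))
    (h1 : ∀ᵐ x : ℝ, x ∈ Icc (a + δ) (a + 2 * δ) → f x ≤ ε)
    (h2 : ∀ᵐ x : ℝ, x ∈ Icc (b - 2 * δ) (b - δ) → -f x ≤ ε) :
    0 ≤ ∫ x, (P x * max (f x) 0 + Q x * max (-f x) 0) ∧
    ∫ x, (P x * max (f x) 0 + Q x * max (-f x) 0) ≤ 2 * K * ε := by
  have nn : ∀ x, 0 ≤ P x * max (f x) 0 + Q x * max (-f x) 0 := fun x =>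
    add_nonneg (mul_nonneg (hP _).1 (le_max_right _ _)) (mul_nonneg (hQ _).1 (le_max_right _ _))
  refine ⟨integral_nonneg nn, ?_⟩
  have i1 : Integrable ((Icc (a + δ) (a + 2 * δ)).indicator fun _ : ℝ => K / δ * ε) := by
    rw [integrable_indicator_iff measurableSet_Icc]
    exact integrableOn_const measure_Icc_lt_top.ne
  have i2 : Integrable ((Icc (b - 2 * δ) (b - δ)).indicator fun _ : ℝ => K / δ * ε) := by
    rw [integrable_indicator_iff measurableSet_Icc]
    exact integrableOn_const measure_Icc_lt_top.ne
  have hle := integral_mono_of_nonneg (Eventually.of_forall nn) (i1.add i2) (by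
    filter_upwards [h1, h2] with x hx1 hx2
    rw [Pi.add_apply]
    refine add_le_add ?_ ?_
    · by_cases hx : x ∈ Icc (a + δ) (a + 2 * δ)
      · rw [indicator_of_mem hx]
        exact mul_le_mul (hP x).2.1 (max_le (hx1 hx) hε) (le_max_right _ _) (by positivity)
      · rw [indicator_of_notMem hx, (hP x).2.2 hx, zero_mul]
    · by_cases hx : x ∈ Icc (b - 2 * δ) (b - δ)
      · rw [indicator_of_mem hx]
        exact mul_le_mul (hQ x).2.1 (max_le (hx2 hx) hε) (le_max_right _ _) (by positivity)
      · rw [indicator_of_notMem hx, (hQ x).2.2 hx, zero_mul])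
  refine hle.trans_eq ?_
  rw [integral_add' i1 i2, integral_indicator_const _ measurableSet_Icc,
    integral_indicator_const _ measurableSet_Icc]
  rw [Real.volume_real_Icc_of_le (by linarith), Real.volume_real_Icc_of_le (by linarith)]
  simp only [smul_eq_mul]
  field_simp
  ring

lemma fatou_step (a b : ℝ) (χ : ℕ → ℝ → ℝ) (hχm : ∀ n, Measurable (χ n))
    (hχ1 : ∀ n x, 0 ≤ χ n x ∧ χ n x ≤ 1) (hχs : ∀ n x, x ∉ Ioo a b → χ n x = 0)
    (hχt : ∀ x ∈ Ioo a b, ∀ᶠ n in atTop, χ n x = 1)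
    (D1 D2 : ℝ → ℝ) (hD1m : Measurable D1) (hD1 : ∀ x, 0 ≤ D1 x) (hD2 : ∀ x, 0 ≤ D2 x)
    (i1 : ∀ n, Integrable (fun x => D1 x * χ n x)) (i2 : ∀ n, Integrable (fun x => D2 x * χ n x))
    (ε : ℕ → ℝ) (hε : Tendsto ε atTop (𝓝 0))
    (H : ∀ n, ∫ x, D1 x * χ n x ≤ (∫ x, D2 x * χ n x) + ε n) :
    ∫⁻ x in Ioo a b, ENNReal.ofReal (D1 x) ≤ ∫⁻ x in Ioo a b, ENNReal.ofReal (D2 x) := by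
  set L := ∫⁻ x in Ioo a b, ENNReal.ofReal (D2 x) with hL
  have step : ∀ n, ∫⁻ x in Ioo a b, ENNReal.ofReal (D1 x * χ n x) ≤ L + ENNReal.ofReal (ε n) := by
    intro n
    calc ∫⁻ x in Ioo a b, ENNReal.ofReal (D1 x * χ n x)
        ≤ ∫⁻ x, ENNReal.ofReal (D1 x * χ n x) := setLIntegral_le_lintegral _ _
      _ = ENNReal.ofReal (∫ x, D1 x * χ n x) :=
          (ofReal_integral_eq_lintegral_ofReal (i1 n)
            (Eventually.of_forall fun x => mul_nonneg (hD1 x) (hχ1 n x).1)).symm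
      _ ≤ ENNReal.ofReal ((∫ x, D2 x * χ n x) + ε n) := ENNReal.ofReal_le_ofReal (H n)
      _ ≤ ENNReal.ofReal (∫ x, D2 x * χ n x) + ENNReal.ofReal (ε n) := ENNReal.ofReal_add_le
      _ = (∫⁻ x, ENNReal.ofReal (D2 x * χ n x)) + ENNReal.ofReal (ε n) := by
          rw [ofReal_integral_eq_lintegral_ofReal (i2 n)
            (Eventually.of_forall fun x => mul_nonneg (hD2 x) (hχ1 n x).1)]
      _ ≤ L + ENNReal.ofReal (ε n) := by
          refine add_le_add ?_ le_rfl
          rw [hL, ← lintegral_indicator measurableSet_Ioo]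
          refine lintegral_mono fun x => ?_
          by_cases hx : x ∈ Ioo a b
          · rw [indicator_of_mem hx]
            exact ENNReal.ofReal_le_ofReal (mul_le_of_le_one_right (hD2 x) (hχ1 n x).2)
          · rw [hχs n x hx, mul_zero]; simp
  have lim : Tendsto (fun n => L + ENNReal.ofReal (ε n)) atTop (𝓝 L) := by
    have := (tendsto_const_nhds (x := L)).add (ENNReal.tendsto_ofReal hε)
    simpa using this
  calc ∫⁻ x in Ioo a b, ENNReal.ofReal (D1 x)
      = ∫⁻ x in Ioo a b, liminf (fun n => ENNReal.ofReal (D1 x * χ n x)) atTop := by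
        refine setLIntegral_congr_fun measurableSet_Ioo fun x hx => ?_
        symm
        apply Tendsto.liminf_eq
        apply tendsto_const_nhds.congr'
        filter_upwards [hχt x hx] with n hn
        rw [hn, mul_one]
    _ ≤ liminf (fun n => ∫⁻ x in Ioo a b, ENNReal.ofReal (D1 x * χ n x)) atTop :=
        lintegral_liminf_le fun n => (hD1m.mul (hχm n)).ennreal_ofReal
    _ ≤ liminf (fun n => L + ENNReal.ofReal (ε n)) atTop :=
        liminf_le_liminf (Eventually.of_forall step)
    _ = L := lim.liminf_eq

lemma integrable_cut (D χ : ℝ → ℝ) (c d B : ℝ) (hD : Measurable D) (hχ : Measurable χ)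
    (hχ1 : ∀ x, 0 ≤ χ x ∧ χ x ≤ 1) (hχs : ∀ x, x ∉ Icc c d → χ x = 0)
    (hB : ∀ᵐ x : ℝ, x ∈ Icc c d → |D x| ≤ B) : Integrable (fun x => D x * χ x) := by
  have hs : Function.support (fun x => D x * χ x) ⊆ Icc c d := by
    intro x hx
    by_contra hc
    exact hx (by simp [hχs x hc])
  rw [← integrableOn_iff_integrable_of_support_subset hs]
  refine Measure.integrableOn_of_bounded (M := B * 1) measure_Icc_lt_top.ne
    (hD.mul hχ).aestronglyMeasurable ?_
  rw [ae_restrict_iff' measurableSet_Icc]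
  filter_upwards [hB] with x hx hxm
  refine abs_mul_le_mul' (hx hxm) ?_
  rw [abs_of_nonneg (hχ1 _).1]; exact (hχ1 _).2

end partTen

section partEleven
open Topology NNReal

lemma edge_limit (g h : ℝ → ℝ) (hgc : Continuous g)
    (hS : h 0 = 0) (hmo : MonotoneOn h (Ici 0)) (han : AntitoneOn h (Iic 0))
    (a b : ℝ) (hga : g a = 0) (hgb : g b = 0) (hab : a < b)
    (hgpos : ∀ x ∈ Ioo a b, 0 < g x) (y z : ℝ → ℝ)
    (hif : ∃ δ > (0 : ℝ), ∃ R > (0 : ℝ),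
      (∀ᵐ x : ℝ, x ∈ Ioo a (a + δ) → y x ≤ R ∧ z x ≤ R) ∧
      (∀ᵐ x : ℝ, x ∈ Ioo (b - δ) b → -R ≤ y x ∧ -R ≤ z x)) (ε : ℝ) (hε : 0 < ε) :
    ∃ η > 0, ∀ δ : ℝ, 0 < δ → δ < η →
      (∀ᵐ x : ℝ, x ∈ Icc (a + δ) (a + 2 * δ) → sgn (y x - z x) * (h (y x) - h (z x)) * g x ≤ ε) ∧
      (∀ᵐ x : ℝ, x ∈ Icc (b - 2 * δ) (b - δ) →
        -(sgn (y x - z x) * (h (y x) - h (z x)) * g x) ≤ ε) := by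
  obtain ⟨δ0, hδ0, R, hR, h1, h2⟩ := hif
  have c1 : ∀ᶠ x in 𝓝 a, h R * g x < ε := by
    have : Tendsto (fun x => h R * g x) (𝓝 a) (𝓝 (h R * g a)) := (hgc.tendsto a).const_mul _
    rw [hga, mul_zero] at this
    exact this.eventually (gt_mem_nhds hε)
  have c2 : ∀ᶠ x in 𝓝 b, h (-R) * g x < ε := by
    have : Tendsto (fun x => h (-R) * g x) (𝓝 b) (𝓝 (h (-R) * g b)) := (hgc.tendsto b).const_mul _
    rw [hgb, mul_zero] at this
    exact this.eventually (gt_mem_nhds hε)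
  obtain ⟨r1, hr1, c1⟩ := Metric.eventually_nhds_iff.1 c1
  obtain ⟨r2, hr2, c2⟩ := Metric.eventually_nhds_iff.1 c2
  refine ⟨min (min r1 r2) (min δ0 (b - a)) / 2, ?_, ?_⟩
  · have : 0 < b - a := by linarith
    positivity
  intro δ hδ hδη
  have q0 : 2 * δ < min (min r1 r2) (min δ0 (b - a)) := by linarith
  have q1 : 2 * δ < r1 := q0.trans_le ((min_le_left _ _).trans (min_le_left _ _))
  have q2 : 2 * δ < r2 := q0.trans_le ((min_le_left _ _).trans (min_le_right _ _))
  have q3 : 2 * δ < δ0 := q0.trans_le ((min_le_right _ _).trans (min_le_left _ _))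
  have q4 : 2 * δ < b - a := q0.trans_le ((min_le_right _ _).trans (min_le_right _ _))
  constructor
  · filter_upwards [h1] with x hx hxm
    have hx' := hx ⟨by linarith [hxm.1], by linarith [hxm.2]⟩
    have hg0 := hgpos x ⟨by linarith [hxm.1], by linarith [hxm.2]⟩
    have hc : h R * g x < ε := c1 (by
      rw [Real.dist_eq, abs_lt]; constructor <;> linarith [hxm.1, hxm.2])
    have := mul_le_mul_of_nonneg_right (flux_upper h hS hmo han R _ _ hR hx'.1 hx'.2) hg0.le
    linarith
  · filter_upwards [h2] with x hx hxm
    have hx' := hx ⟨by linarith [hxm.1], by linarith [hxm.2]⟩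
    have hg0 := hgpos x ⟨by linarith [hxm.1], by linarith [hxm.2]⟩
    have hc : h (-R) * g x < ε := c2 (by
      rw [Real.dist_eq, abs_lt]; constructor <;> linarith [hxm.1, hxm.2])
    have := mul_le_mul_of_nonneg_right (flux_lower h hS hmo han R _ _ hR hx'.1 hx'.2) hg0.le
    linarith

end partEleven

theorem statement5 (g h : ℝ → ℝ) (hg : LocallyLipschitz g) (hh : ContDiff ℝ 2 h)
    (hS : h 0 = 0) (hS' : deriv h 0 = 0) (hSC : StrictMono (deriv h))
    (a b T : ℝ) (hab : a < b) (hga : g a = 0) (hgb : g b = 0)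
    (hgpos : ∀ x ∈ Ioo a b, 0 < g x) (hT : 0 < T)
    (u v : ℝ × ℝ → ℝ) (hum : Measurable u) (hvm : Measurable v)
    (huint : LocallyIntegrableOn u (Ioo a b ×ˢ Ioo 0 T) volume)
    (hvint : LocallyIntegrableOn v (Ioo a b ×ˢ Ioo 0 T) volume)
    (hufb : ∃ C : ℝ, ∀ᵐ p : ℝ × ℝ, p ∈ Ioo a b ×ˢ Ioo 0 T → |g p.1 * h (u p)| ≤ C)
    (hvfb : ∃ C : ℝ, ∀ᵐ p : ℝ × ℝ, p ∈ Ioo a b ×ˢ Ioo 0 T → |g p.1 * h (v p)| ≤ C)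
    (huent : InteriorEntropy g h a b T u) (hvent : InteriorEntropy g h a b T v)
    (hiface : ∀ᵐ t ∂(volume.restrict (Ioo 0 T)), ∃ δ > (0 : ℝ), ∃ R > (0 : ℝ),
      (∀ᵐ x : ℝ, x ∈ Ioo a (a + δ) → u (x, t) ≤ R ∧ v (x, t) ≤ R) ∧
      (∀ᵐ x : ℝ, x ∈ Ioo (b - δ) b → -R ≤ u (x, t) ∧ -R ≤ v (x, t))) :
    ∃ S : Set ℝ, S ⊆ Ioo 0 T ∧ volume (Ioo 0 T \ S) = 0 ∧
      ∀ σ ∈ S, ∀ τ ∈ S, σ < τ →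
        (∫⁻ x in Ioo a b, ENNReal.ofReal |u (x, τ) - v (x, τ)|) ≤
          ∫⁻ x in Ioo a b, ENNReal.ofReal |u (x, σ) - v (x, σ)| := by
  obtain ⟨Cu, hCu⟩ := hufb
  obtain ⟨Cv, hCv⟩ := hvfb
  set C : ℝ := max (max Cu Cv) 0 with hCdef
  have hC0 : 0 ≤ C := le_max_right _ _
  have hCu' : ∀ᵐ p : ℝ × ℝ, p ∈ Ioo a b ×ˢ Ioo 0 T → |g p.1 * h (u p)| ≤ C := by
    filter_upwards [hCu] with p hp hpm
    exact (hp hpm).trans ((le_max_left _ _).trans (le_max_left _ _))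
  have hCv' : ∀ᵐ p : ℝ × ℝ, p ∈ Ioo a b ×ˢ Ioo 0 T → |g p.1 * h (v p)| ≤ C := by
    filter_upwards [hCv] with p hp hpm
    exact (hp hpm).trans ((le_max_right _ _).trans (le_max_left _ _))
  have hgc : Continuous g := hg.continuous
  have hgm : Measurable g := hgc.measurable
  have hhm : Measurable h := hh.continuous.measurable
  have hsm := measurable_sgn
  obtain ⟨hmo, han⟩ := h_mono_anti h hh hS' hSC
  set D : ℝ × ℝ → ℝ := fun p => |u p - v p| with hDdef
  set F : ℝ × ℝ → ℝ := fun p => sgn (u p - v p) * (h (u p) - h (v p)) * g p.1 with hFdef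
  have hDm : Measurable D := by fun_prop
  have hFm : Measurable F := by fun_prop
  have hFb : ∀ᵐ p : ℝ × ℝ, p ∈ Ioo a b ×ˢ Ioo 0 T → |F p| ≤ 2 * C := by
    filter_upwards [hCu', hCv'] with p h1 h2 hpm
    have h3 := h1 hpm
    have h4 := h2 hpm
    have : F p = sgn (u p - v p) * (g p.1 * h (u p) - g p.1 * h (v p)) := by
      simp only [hFdef]; ring
    rw [this, abs_mul, abs_sgn, one_mul]
    have := abs_sub_le_add (g p.1 * h (u p)) (g p.1 * h (v p))
    linarith
  obtain ⟨K, hK0, hK⟩ := exists_cutoff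
  set δ : ℕ → ℝ := fun n => (b - a) / 4 * (1 / ((n : ℝ) + 1)) with hδdef
  have hba : 0 < b - a := by linarith
  have hδ0 : ∀ n, 0 < δ n := fun n => by simp only [hδdef]; positivity
  have hδ1 : ∀ n, δ n ≤ (b - a) / 4 := fun n => by
    have : 1 / ((n : ℝ) + 1) ≤ 1 := by
      rw [div_le_one (by positivity)]; linarith [Nat.cast_nonneg (α := ℝ) n]
    simp only [hδdef]
    exact mul_le_of_le_one_right (by positivity) this
  have hδt : Tendsto δ atTop (nhds 0) := by
    have := (tendsto_one_div_add_atTop_nhds_zero_nat (𝕜 := ℝ)).const_mul ((b - a) / 4)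
    rw [mul_zero] at this
    exact this
  choose χ P Q hχc hχ1 hχs hχone hχd hPm hQm hP hQ hPQ using fun n => hK a b (δ n) (hδ0 n)
  choose M hM0 hM hkato using fun n => kato_local g h hg hh hS' hSC a b T hgpos u v hum hvm C
    hCu' hCv' huent hvent (a + δ n / 2) (b - δ n / 2) (by linarith [hδ0 n]) (by linarith [hδ0 n])
    (by linarith [hδ0 n, hδ1 n])
  have hDb : ∀ n, ∀ᵐ p : ℝ × ℝ, p ∈ Icc (a + δ n) (b - δ n) ×ˢ Ioo 0 T → |D p| ≤ 2 * M n := by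
    intro n
    filter_upwards [hM n] with p hp hpm
    have := hp ⟨⟨by linarith [hpm.1.1, hδ0 n], by linarith [hpm.1.2, hδ0 n]⟩, hpm.2⟩
    simp only [hDdef]
    rw [abs_abs]
    linarith [abs_sub_le_add (u p) (v p)]
  have hst := fun n => strip D F hDm hFm (a + δ n / 2) (b - δ n / 2) (a + δ n) (b - δ n) T
    (by linarith [hδ0 n]) (by linarith [hδ0 n]) (2 * M n) (2 * C) (K / δ n) (hDb n)
    (by
      filter_upwards [hFb] with p hp hpm
      exact hp ⟨⟨by linarith [hpm.1.1, hδ0 n], by linarith [hpm.1.2, hδ0 n]⟩, hpm.2⟩)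
    (hkato n) (χ n) (P n) (Q n) (hχc n) (hχ1 n) (hχs n) (hχd n) (hPm n) (hQm n)
    (fun x => ⟨(hP n x).1, (hP n x).2.1⟩) (fun x => ⟨(hQ n x).1, (hQ n x).2.1⟩) (hPQ n)
  set e : ℕ → ℝ → ℝ := fun n t => (Ioo 0 T).indicator
        (fun t => ∫ x, (P n x * max (F (x, t)) 0 + Q n x * max (-F (x, t)) 0)) t with hedef
  have hei : ∀ n, Integrable (e n) := fun n => (hst n).1
  choose S hSae hSm using fun n => (hst n).2
  have hFslice := ae_slice hFb
  have hiface' := (ae_restrict_iff' measurableSet_Ioo).1 hiface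
  have helim : Tendsto (fun n => ∫ t, e n t) atTop (nhds 0) := by
    have := tendsto_integral_of_dominated_convergence (F := e) (f := fun _ => (0 : ℝ))
      (μ := volume) (bound := (Ioo 0 T).indicator fun _ => 2 * K * (2 * C))
      (fun n => (hei n).aestronglyMeasurable) (by
        rw [integrable_indicator_iff measurableSet_Ioo]
        exact integrableOn_const measure_Ioo_lt_top.ne) (by
        intro n
        filter_upwards [hFslice] with t ht
        by_cases htm : t ∈ Ioo 0 T
        · simp only [hedef]
          rw [indicator_of_mem htm, indicator_of_mem htm]
          have eb := edge_bound a b (δ n) K (2 * C) (hδ0 n) hK0 (by linarith) (P n) (Q n)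
            (fun x => F (x, t)) (hP n) (hQ n) (by
              filter_upwards [ht] with x hx hxm
              exact (le_abs_self _).trans (hx ⟨⟨by linarith [hxm.1, hδ0 n],
                by linarith [hxm.2, hδ1 n]⟩, htm⟩)) (by
              filter_upwards [ht] with x hx hxm
              exact (neg_le_abs _).trans (hx ⟨⟨by linarith [hxm.1, hδ1 n],
                by linarith [hxm.2, hδ0 n]⟩, htm⟩))
          rw [Real.norm_eq_abs, abs_of_nonneg eb.1]
          exact eb.2
        · simp only [hedef]
          rw [indicator_of_notMem htm, indicator_of_notMem htm, norm_zero]) (by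
        filter_upwards [hiface'] with t ht
        by_cases htm : t ∈ Ioo 0 T
        · rw [Metric.tendsto_atTop]
          intro ε hε
          have hε' : 0 < ε / (2 * K + 1) := by positivity
          obtain ⟨η, hη, hη2⟩ := edge_limit g h hgc hS hmo han a b hga hgb hab hgpos
            (fun x => u (x, t)) (fun x => v (x, t)) (ht htm) (ε / (2 * K + 1)) hε'
          obtain ⟨N, hN⟩ := eventually_atTop.1 (hδt.eventually (gt_mem_nhds hη))
          refine ⟨N, fun n hn => ?_⟩
          obtain ⟨l1, l2⟩ := hη2 (δ n) (hδ0 n) (hN n hn)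
          have eb := edge_bound a b (δ n) K (ε / (2 * K + 1)) (hδ0 n) hK0 hε'.le (P n) (Q n)
            (fun x => F (x, t)) (hP n) (hQ n) l1 l2
          simp only [hedef]
          rw [indicator_of_mem htm, Real.dist_eq, sub_zero, abs_of_nonneg eb.1]
          refine eb.2.trans_lt ?_
          rw [mul_div_assoc', div_lt_iff₀ (by positivity)]
          nlinarith
        · simp only [hedef]
          simp only [indicator_of_notMem htm]
          exact tendsto_const_nhds)
    simpa using this
  have hgood : ∀ᵐ t : ℝ, ∀ n, t ∈ S n ∧ (∀ᵐ x : ℝ,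
      (x, t) ∈ Icc (a + δ n) (b - δ n) ×ˢ Ioo 0 T → |D (x, t)| ≤ 2 * M n) := by
    rw [ae_all_iff]
    intro n
    filter_upwards [hSae n, ae_slice (hDb n)] with t h1 h2 using ⟨h1, h2⟩
  refine ⟨{t | t ∈ Ioo 0 T ∧ ∀ n, t ∈ S n ∧ (∀ᵐ x : ℝ,
      (x, t) ∈ Icc (a + δ n) (b - δ n) ×ˢ Ioo 0 T → |D (x, t)| ≤ 2 * M n)},
    fun t ht => ht.1, ?_, ?_⟩
  · refine measure_mono_null ?_ (ae_iff.1 hgood)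
    intro t ht hcon
    exact ht.2 ⟨ht.1, hcon⟩
  intro σ hσ τ hτ hστ
  have icut : ∀ t, (t ∈ Ioo 0 T ∧ ∀ n, t ∈ S n ∧ (∀ᵐ x : ℝ,
      (x, t) ∈ Icc (a + δ n) (b - δ n) ×ˢ Ioo 0 T → |D (x, t)| ≤ 2 * M n)) →
      ∀ n, Integrable (fun x => D (x, t) * χ n x) := by
    intro t ht n
    refine integrable_cut (fun x => D (x, t)) (χ n) (a + δ n) (b - δ n) (2 * M n)
      (by fun_prop) (hχc n).continuous.measurable (hχ1 n) (hχs n) ?_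
    filter_upwards [(ht.2 n).2] with x hx hxm using hx ⟨hxm, ht.1⟩
  refine fatou_step a b χ (fun n => (hχc n).continuous.measurable) hχ1 ?_ ?_
    (fun x => D (x, τ)) (fun x => D (x, σ)) (by fun_prop) (fun x => abs_nonneg _)
    (fun x => abs_nonneg _) (icut τ hτ) (icut σ hσ) (fun n => ∫ t, e n t) helim ?_
  · intro n x hx
    apply hχs
    intro hx'
    exact hx ⟨by linarith [hx'.1, hδ0 n], by linarith [hx'.2, hδ0 n]⟩
  · intro x hx
    have hpos : 0 < min (x - a) (b - x) / 2 := by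
      have h1 : 0 < x - a := by linarith [hx.1]
      have h2 : 0 < b - x := by linarith [hx.2]
      positivity
    filter_upwards [hδt.eventually (gt_mem_nhds hpos)] with n hn
    apply hχone
    have h1 := min_le_left (x - a) (b - x)
    have h2 := min_le_right (x - a) (b - x)
    constructor <;> linarith
  · intro n
    exact hSm n σ (hσ.2 n).1 τ (hτ.2 n).1 hσ.1.1 hστ hτ.1.2
end

section
/- Let T > 0 and let u : ℝ × [0,T) → ℝ be continuously differentiable with u(x,0) = −1 for all x ∈ ℝ, bounded on ℝ × [0,τ] for every τ < T, and satisfying the classical form of the conservation law u_t + (x u² + u⁴)_x = 0, i.e. ∂_t u(x,t) + u(x,t)² + (2x·u(x,t) + 4·u(x,t)³)·∂_x u(x,t) = 0 for all (x,t) ∈ ℝ × (0,T). Then u(x,t) = 1/(t − 1) for all (x,t) ∈ ℝ × [0,T), and consequently T ≤ 1. In particular, the Cauchy problem for u_t + (x u² + u⁴)_x = 0 with initial datum u₀ ≡ −1 admits no classical solution on ℝ × [0,T) for any T > 1: the solution blows up everywhere in space at time t = 1. -/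
open MeasureTheory Set Filter

/-- A negative derivative at `0` gives larger values just to the left. -/
lemma exists_left_gt {g : ℝ → ℝ} {d : ℝ} (hg : HasDerivAt g d 0) (hd : d < 0)
    {P : ℝ → Prop} (hP : ∀ᶠ s in nhdsWithin (0 : ℝ) (Iio 0), P s) :
    ∃ s, s < 0 ∧ P s ∧ g 0 < g s := by
  have h1 := (hasDerivAt_iff_tendsto_slope.1 hg).eventually (Iio_mem_nhds hd)
  have h2 : ∀ᶠ s in nhdsWithin (0 : ℝ) (Iio 0), slope g 0 s < 0 :=
    h1.filter_mono (nhdsWithin_mono _ (fun s hs => ne_of_lt hs))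
  obtain ⟨s, hs1, hs2, hs3⟩ := (h2.and (hP.and self_mem_nhdsWithin)).exists
  have hs3' : s < 0 := hs3
  refine ⟨s, hs3, hs2, ?_⟩
  rw [slope_def_field, sub_zero] at hs1
  by_contra hc
  have : 0 ≤ (g s - g 0) / s := div_nonneg_of_nonpos (by linarith) hs3'.le
  linarith

lemma key_zero (T : ℝ) (u : ℝ × ℝ → ℝ)
    (hreg : ContDiffOn ℝ 1 u (univ ×ˢ Ico 0 T))
    (hinit : ∀ x : ℝ, u (x, 0) = -1)
    (hbdd : ∀ τ : ℝ, τ < T → ∃ M : ℝ, ∀ x t : ℝ, 0 ≤ t → t ≤ τ → |u (x, t)| ≤ M)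
    (hPDE : ∀ x t : ℝ, 0 < t → t < T →
      fderiv ℝ u (x, t) (0, 1) + (u (x, t)) ^ 2
        + (2 * x * u (x, t) + 4 * (u (x, t)) ^ 3) * fderiv ℝ u (x, t) (1, 0) = 0)
    (x₀ τ : ℝ) (h0 : 0 ≤ τ) (hτ : τ < T) : u (x₀, τ) * (τ - 1) - 1 = 0 := by
  obtain ⟨M, hM⟩ := hbdd τ hτ
  have hM0 : 0 ≤ M := (abs_nonneg _).trans (hM 0 0 le_rfl h0)
  by_contra hne
  set l : ℝ := 6 * M + 8 * M ^ 3 + 1 with hl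
  have hl0 : 0 ≤ l := by positivity
  set G : ℝ × ℝ → ℝ := fun p =>
    (u p * (p.2 - 1) - 1) ^ 2 * Real.exp (-l * p.2) / (1 + p.1 ^ 2) with hG
  have hG0 : 0 < G (x₀, τ) := by
    have : 0 < (u (x₀, τ) * (τ - 1) - 1) ^ 2 := by positivity
    simp only [hG]; positivity
  set C : ℝ := (M * (τ + 1) + 1) ^ 2 with hC
  have hGC : ∀ x t : ℝ, 0 ≤ t → t ≤ τ → G (x, t) ≤ C / (1 + x ^ 2) := by
    intro x t ht ht'
    simp only [hG]
    gcongr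
    have h1 : |u (x, t) * (t - 1) - 1| ≤ M * (τ + 1) + 1 := by
      have ha : |t - 1| ≤ τ + 1 := by rw [abs_le]; constructor <;> linarith
      calc _ ≤ |u (x, t) * (t - 1)| + |(1 : ℝ)| := abs_sub _ _
        _ ≤ _ := by
          rw [abs_mul, abs_one]
          gcongr
          exact hM x t ht ht'
    have h2 : (u (x, t) * (t - 1) - 1) ^ 2 ≤ C := sq_le_sq.2 (h1.trans (le_abs_self _))
    have h3 : Real.exp (-l * t) ≤ 1 := Real.exp_le_one_iff.2 (by nlinarith)
    calc _ ≤ (u (x, t) * (t - 1) - 1) ^ 2 * 1 := by gcongr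
      _ ≤ C := by linarith
  have hC0 : 0 ≤ C := sq_nonneg _
  set R : ℝ := |x₀| + C / G (x₀, τ) + 1 with hR
  have hq : 0 ≤ C / G (x₀, τ) := by positivity
  have hRx : |x₀| ≤ R := by linarith
  have hR1 : 1 ≤ R := by linarith [abs_nonneg x₀]
  have hRbig : C / (1 + R ^ 2) < G (x₀, τ) := by
    rw [div_lt_iff₀ (by positivity), mul_comm, ← div_lt_iff₀ hG0]
    nlinarith [abs_nonneg x₀]
  have hcont : ContinuousOn G (Icc (-R) R ×ˢ Icc 0 τ) := by
    have hu : ContinuousOn u (Icc (-R) R ×ˢ Icc 0 τ) :=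
      hreg.continuousOn.mono (prod_mono (subset_univ _)
        (fun t ht => ⟨ht.1, ht.2.trans_lt hτ⟩))
    refine ContinuousOn.div (ContinuousOn.mul ?_ ?_) ?_ (fun p _ => by positivity)
    · exact ((hu.mul (by fun_prop)).sub continuousOn_const).pow 2
    · fun_prop
    · fun_prop
  obtain ⟨⟨x, t⟩, ⟨hx, ht⟩, hmax⟩ := (isCompact_Icc.prod isCompact_Icc).exists_isMaxOn
    ⟨(x₀, τ), ⟨abs_le.1 hRx, ⟨h0, le_rfl⟩⟩⟩ hcont
  simp only at hx ht
  have hmx : G (x₀, τ) ≤ G (x, t) := hmax ⟨abs_le.1 hRx, ⟨h0, le_rfl⟩⟩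
  have hGp : 0 < G (x, t) := hG0.trans_le hmx
  have ht0 : 0 < t := by
    rcases ht.1.lt_or_eq with h | h
    · exact h
    · exfalso
      subst h
      simp [hG, hinit] at hGp
  have htT : t < T := ht.2.trans_lt hτ
  have hxR : x ^ 2 < R ^ 2 := by
    by_contra hc
    push Not at hc
    have h1 := hGC x t ht.1 ht.2
    have h2 : C / (1 + x ^ 2) ≤ C / (1 + R ^ 2) := by gcongr
    linarith
  have hxl : -R < x ∧ x < R := abs_lt.1 (abs_lt_of_sq_lt_sq hxR (by linarith))
  set v := u (x, t) with hv
  have hvM : |v| ≤ M := hM x t ht.1 ht.2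
  set a : ℝ := 2 * x * v + 4 * v ^ 3 with ha
  have hdiff : DifferentiableAt ℝ u (x, t) :=
    (hreg.differentiableOn one_ne_zero).differentiableAt
      (prod_mem_nhds univ_mem (Ico_mem_nhds ht0 htT))
  have hlin : fderiv ℝ u (x, t) (a, 1) = -v ^ 2 := by
    have h1 : ((a, 1) : ℝ × ℝ) = (0, 1) + a • (1, 0) := by simp
    rw [h1, map_add, map_smul, smul_eq_mul]
    linarith [hPDE x t ht0 htT]
  have hX : HasDerivAt (fun s : ℝ => x + a * s) a 0 := by
    simpa using ((hasDerivAt_id (0 : ℝ)).const_mul a).const_add x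
  have hS : HasDerivAt (fun s : ℝ => t + s) 1 0 := (hasDerivAt_id (0 : ℝ)).const_add t
  have hU : HasDerivAt (fun s : ℝ => u (x + a * s, t + s)) (-v ^ 2) 0 := by
    have hd : HasFDerivAt u (fderiv ℝ u (x, t)) (x + a * 0, t + 0) := by
      simpa using hdiff.hasFDerivAt
    have := hd.comp_hasDerivAt (0 : ℝ) (hX.prodMk hS)
    rwa [hlin] at this
  have hD := ((((hU.mul (hS.sub_const 1)).sub_const 1).pow 2).mul
    ((hS.const_mul (-l)).exp)).div ((hX.pow 2).const_add 1)
    (by simp only [Pi.pow_apply]; positivity)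
  have hgd : HasDerivAt (fun s : ℝ => G (x + a * s, t + s))
      ((-2 * v - l - 2 * x * a / (1 + x ^ 2)) * G (x, t)) 0 := by
    refine HasDerivAt.congr_deriv (f' := _) hD ?_
    have : (1 + x ^ 2) ≠ 0 := by positivity
    simp [hG, ← hv]
    field_simp
    ring
  have hneg : (-2 * v - l - 2 * x * a / (1 + x ^ 2)) * G (x, t) < 0 := by
    refine mul_neg_of_neg_of_pos ?_ hGp
    have hv3 : |v ^ 3| ≤ M ^ 3 := by rw [abs_pow]; gcongr
    obtain ⟨hv1, hv2⟩ := abs_le.1 hvM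
    have hb : -(4 * M + 8 * M ^ 3) ≤ 2 * x * a / (1 + x ^ 2) := by
      rw [le_div_iff₀ (by positivity)]
      have e1 : -(M ^ 3 * (1 + x ^ 2)) ≤ x * v ^ 3 := by
        have : |x * v ^ 3| ≤ (1 + x ^ 2) * M ^ 3 := by
          rw [abs_mul]
          gcongr
          rw [abs_le]; constructor <;> nlinarith [sq_nonneg (x - 1), sq_nonneg (x + 1)]
        linarith [(abs_le.1 this).1]
      have e2 : 0 ≤ x ^ 2 * (v + M) := mul_nonneg (sq_nonneg x) (by linarith)
      rw [ha]
      nlinarith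
    linarith
  have hev : ∀ᶠ s in nhdsWithin (0 : ℝ) (Iio 0),
      (x + a * s, t + s) ∈ Icc (-R) R ×ˢ Icc 0 τ := by
    have c1 : Tendsto (fun s : ℝ => x + a * s) (nhds 0) (nhds x) := by
      simpa using hX.continuousAt.tendsto
    have c2 : Tendsto (fun s : ℝ => t + s) (nhds 0) (nhds t) := by
      simpa using hS.continuousAt.tendsto
    filter_upwards [self_mem_nhdsWithin,
      nhdsWithin_le_nhds (c1.eventually (Icc_mem_nhds hxl.1 hxl.2)),
      nhdsWithin_le_nhds (c2.eventually (lt_mem_nhds ht0))] with s hs h1 h2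
    have hs' : s < 0 := hs
    exact ⟨h1, ⟨le_of_lt h2, by simp only; linarith [ht.2]⟩⟩
  obtain ⟨s, -, hs1, hs2⟩ := exists_left_gt hgd hneg hev
  have h3 : G (x + a * s, t + s) ≤ G (x, t) := hmax hs1
  simp only [mul_zero, add_zero] at hs2
  linarith

/-- global ill-posedness for the flux `f(x,u) = x u² + u⁴`.
Any classical (C¹, locally-in-time bounded) solution on `ℝ × [0,T)` with initial
datum `u₀ ≡ −1` must equal `1/(t−1)`, forcing `T ≤ 1`: the solution blows up
everywhere in space at time `t = 1`. Points of `ℝ × ℝ` are written `(x, t)`. -/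
theorem statement6 (T : ℝ) (hT : 0 < T) (u : ℝ × ℝ → ℝ)
    (hreg : ContDiffOn ℝ 1 u (univ ×ˢ Ico 0 T))
    (hinit : ∀ x : ℝ, u (x, 0) = -1)
    (hbdd : ∀ τ : ℝ, τ < T → ∃ M : ℝ, ∀ x t : ℝ, 0 ≤ t → t ≤ τ → |u (x, t)| ≤ M)
    (hPDE : ∀ x t : ℝ, 0 < t → t < T →
      fderiv ℝ u (x, t) (0, 1) + (u (x, t)) ^ 2
        + (2 * x * u (x, t) + 4 * (u (x, t)) ^ 3) * fderiv ℝ u (x, t) (1, 0) = 0) :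
    (∀ x t : ℝ, 0 ≤ t → t < T → u (x, t) = 1 / (t - 1)) ∧ T ≤ 1 := by
  have key := key_zero T u hreg hinit hbdd hPDE
  constructor
  · intro x t h0 hT'
    have h := key x t h0 hT'
    have hne : t - 1 ≠ 0 := by
      intro hc
      rw [hc] at h
      norm_num at h
    rw [eq_div_iff hne]
    linarith
  · by_contra hc
    push Not at hc
    have h := key 0 1 zero_le_one hc
    norm_num at h
end

section
/- Define u₀ : ℝ → ℝ by u₀(x) = −1/√(−x) for x < 0 and u₀(x) = 0 for x ≥ 0. Then the time-independent function (x,t) ↦ u₀(x) satisfies the Kružkov entropy inequality for the flux f(x,u) = x·u² with initial datum u₀: for every k ∈ ℝ and every nonnegative φ ∈ C_c^∞(ℝ × ℝ): ∫₀^∞∫_ℝ [ |u₀(x) − k| ∂_tφ + sgn(u₀(x) − k)(x·u₀(x)² − x·k²) ∂_xφ − sgn(u₀(x) − k)·k²·φ ] dx dt + ∫_ℝ |u₀(x) − k| φ(x,0) dx ≥ 0. That is, u₀ is a stationary Kružkov entropy solution of the Cauchy problem for u_t + (x u²)_x = 0 with itself as initial datum. -/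
open MeasureTheory Set Filter

/-- The initial datum `u₀(x) = −1/√(−x)` for `x < 0`, `0` for `x ≥ 0`. -/
noncomputable def uInit (x : ℝ) : ℝ := if x < 0 then -1 / Real.sqrt (-x) else 0

lemma uInit_eq : uInit = (Iio (0:ℝ)).indicator (fun x => -((0 - x) ^ (-(1/2) : ℝ))) := by
  funext x
  unfold uInit
  by_cases hx : x < 0
  · rw [if_pos hx, indicator_of_mem (by simpa using hx), zero_sub, Real.rpow_neg (by linarith),
      ← Real.sqrt_eq_rpow]
    ring
  · rw [if_neg hx, indicator_of_notMem (by simpa using hx)]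

lemma uInit_integrableOn (R : ℝ) : IntegrableOn uInit (Icc (-R) R) := by
  rcases lt_or_ge R 0 with hR | hR
  · rw [Icc_eq_empty (by linarith)]; exact integrableOn_empty
  have h1 : IntervalIntegrable (fun x : ℝ => x ^ (-(1/2) : ℝ)) volume R (-R) :=
    intervalIntegral.intervalIntegrable_rpow' (by norm_num)
  have h2 := h1.comp_sub_left 0
  simp only [zero_sub, neg_neg] at h2
  rw [uInit_eq]
  have h3 : IntegrableOn (fun x : ℝ => -((0 - x) ^ (-(1/2) : ℝ))) (Icc (-R) R) := by
    rw [← intervalIntegrable_iff_integrableOn_Icc_of_le (by linarith)]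
    have h4 := h2.neg
    simp only [zero_sub]
    exact h4
  exact h3.indicator measurableSet_Iio

/-- a compactly supported function on the plane lives in a square -/
lemma exists_square {ψ : ℝ × ℝ → ℝ} (hc : HasCompactSupport ψ) :
    ∃ R : ℝ, ∀ x t, ψ (x, t) ≠ 0 → x ∈ Icc (-R) R ∧ t ∈ Icc (-R) R := by
  obtain ⟨R, hR⟩ := hc.isBounded.subset_closedBall (0 : ℝ × ℝ)
  refine ⟨R, fun x t h => ?_⟩
  have := hR (subset_tsupport _ h)
  rw [mem_closedBall_zero_iff, Prod.norm_def, max_le_iff] at this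
  simp only [Real.norm_eq_abs, abs_le] at this
  exact this

lemma slice_x {ψ : ℝ × ℝ → ℝ} (hc : HasCompactSupport ψ) (t : ℝ) :
    HasCompactSupport (fun x => ψ (x, t)) := by
  obtain ⟨R, hR⟩ := exists_square hc
  exact HasCompactSupport.intro (isCompact_Icc (a := -R) (b := R))
    fun x hx => by_contra fun h => hx (hR x t h).1

lemma slice_t {ψ : ℝ × ℝ → ℝ} (hc : HasCompactSupport ψ) (x : ℝ) :
    HasCompactSupport (fun t => ψ (x, t)) := by
  obtain ⟨R, hR⟩ := exists_square hc
  exact HasCompactSupport.intro (isCompact_Icc (a := -R) (b := R))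
    fun t ht => by_contra fun h => ht (hR x t h).2

lemma abs_integrableOn (k R : ℝ) : IntegrableOn (fun x => |uInit x - k|) (Icc (-R) R) :=
  ((uInit_integrableOn R).sub (integrableOn_const (by simp))).abs

lemma int_prod (k : ℝ) {ψ : ℝ × ℝ → ℝ} (hcont : Continuous ψ) (hc : HasCompactSupport ψ) :
    Integrable (fun p : ℝ × ℝ => |uInit p.1 - k| * ψ p) (volume.prod volume) := by
  obtain ⟨R, hR⟩ := exists_square hc
  obtain ⟨C, hC⟩ := hcont.bounded_above_of_compact_support hc
  have h1 : Integrable ((Icc (-R) R).indicator (fun x => |uInit x - k|)) :=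
    (integrable_indicator_iff measurableSet_Icc).2 (abs_integrableOn k R)
  have h2 : Integrable ((Icc (-R) R).indicator (fun _ : ℝ => (1:ℝ))) :=
    (integrable_indicator_iff measurableSet_Icc).2 (integrableOn_const (by simp))
  have h3 := (h1.mul_prod h2).mul_bdd (c := C) hcont.aestronglyMeasurable (ae_of_all _ hC)
  refine h3.congr (ae_of_all _ ?_)
  rintro ⟨x, t⟩
  by_cases h : ψ (x, t) = 0
  · simp [h]
  · obtain ⟨hx, ht⟩ := hR x t h
    simp [indicator_of_mem hx, indicator_of_mem ht]

lemma int_slice (k t : ℝ) {ψ : ℝ × ℝ → ℝ} (hcont : Continuous ψ) (hc : HasCompactSupport ψ) :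
    Integrable (fun x : ℝ => |uInit x - k| * ψ (x, t)) := by
  obtain ⟨R, hR⟩ := exists_square hc
  obtain ⟨C, hC⟩ := hcont.bounded_above_of_compact_support hc
  have h1 : Integrable ((Icc (-R) R).indicator (fun x => |uInit x - k|)) :=
    (integrable_indicator_iff measurableSet_Icc).2 (abs_integrableOn k R)
  have h3 := h1.mul_bdd (g := fun x => ψ (x, t)) (c := C)
    (by fun_prop : Continuous fun x => ψ (x, t)).aestronglyMeasurable
    (ae_of_all _ fun x => hC (x, t))
  refine h3.congr (ae_of_all _ ?_)
  intro x
  by_cases h : ψ (x, t) = 0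
  · simp [h]
  · simp [indicator_of_mem (hR x t h).1]

/-- Flux of an affine function times a test function: the two sided integrals. -/
lemma affine_deriv (a b : ℝ) (g : ℝ → ℝ) (hg : ContDiff ℝ 1 g) (hgc : HasCompactSupport g) :
    Integrable (fun x => (a + x * b) * deriv g x + b * g x) ∧
    (∀ c, ∫ x in Iic c, ((a + x * b) * deriv g x + b * g x) = (a + c * b) * g c) ∧
    (∀ c, ∫ x in Ioi c, ((a + x * b) * deriv g x + b * g x) = -((a + c * b) * g c)) := by
  have hd : ∀ x, deriv (fun x => (a + x * b) * g x) x = (a + x * b) * deriv g x + b * g x := by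
    intro x
    have h1 : HasDerivAt (fun x : ℝ => a + x * b) b x := by
      simpa using ((hasDerivAt_id x).mul_const b).const_add a
    have h2 := (hg.differentiable (by norm_num) x).hasDerivAt
    refine (h1.mul h2).deriv.trans ?_; ring
  have hC : ContDiff ℝ 1 (fun x => (a + x * b) * g x) := by fun_prop
  have hS : HasCompactSupport (fun x => (a + x * b) * g x) := hgc.mul_left
  refine ⟨?_, fun c => ?_, fun c => ?_⟩
  · simp_rw [← hd]
    exact (hC.continuous_deriv (by norm_num)).integrable_of_hasCompactSupport hS.deriv
  · simp_rw [← hd]; exact hS.integral_Iic_deriv_eq hC c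
  · simp_rw [← hd]; exact hS.integral_Ioi_deriv_eq hC c

lemma uInit_sq {x : ℝ} (hx : x < 0) : x * uInit x ^ 2 = -1 := by
  have h : (Real.sqrt (-x)) ^ 2 = -x := Real.sq_sqrt (by linarith)
  rw [uInit, if_pos hx, div_pow, h]
  have : x ≠ 0 := hx.ne
  field_simp

lemma space_part (k : ℝ) (g : ℝ → ℝ) (hg : ContDiff ℝ 1 g) (hgc : HasCompactSupport g) :
    Integrable (fun x => sgn (uInit x - k) * (x * (uInit x) ^ 2 - x * k ^ 2) * deriv g x
      - sgn (uInit x - k) * k ^ 2 * g x) ∧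
    ∫ x, (sgn (uInit x - k) * (x * (uInit x) ^ 2 - x * k ^ 2) * deriv g x
      - sgn (uInit x - k) * k ^ 2 * g x) = g 0 := by
  set F := fun x => sgn (uInit x - k) * (x * (uInit x) ^ 2 - x * k ^ 2) * deriv g x
      - sgn (uInit x - k) * k ^ 2 * g x with hF
  obtain ⟨hi1, hl1, hr1⟩ := affine_deriv 1 (k ^ 2) g hg hgc
  obtain ⟨hi0, hl0, hr0⟩ := affine_deriv 0 (k ^ 2) g hg hgc
  set H1 := fun x => (1 + x * k ^ 2) * deriv g x + k ^ 2 * g x with hH1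
  set H0 := fun x => (0 + x * k ^ 2) * deriv g x + k ^ 2 * g x with hH0
  have hneg : ∀ x, x < 0 → F x = - sgn (uInit x - k) * H1 x := by
    intro x hx
    simp only [hF, hH1, uInit_sq hx]; ring
  have hpos : ∀ x, 0 < x → F x = - sgn (-k) * H0 x := by
    intro x hx
    have : uInit x = 0 := by rw [uInit, if_neg (by linarith)]
    simp only [hF, hH0, this]; ring_nf
  have hR : IntegrableOn F (Ioi 0) ∧ ∫ x in Ioi 0, F x = 0 := by
    have e : EqOn F (fun x => - sgn (-k) * H0 x) (Ioi 0) := fun x hx => hpos x hx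
    constructor
    · exact (integrableOn_congr_fun e measurableSet_Ioi).2 (hi0.const_mul _).integrableOn
    · rw [setIntegral_congr_fun measurableSet_Ioi e, integral_const_mul, hr0]; simp
  have hL : IntegrableOn F (Iio 0) ∧ ∫ x in Iio 0, F x = g 0 := by
    rcases le_or_gt 0 k with hk | hk
    · have e : EqOn F H1 (Iio 0) := by
        intro x hx
        have hx' : x < 0 := hx
        have : uInit x < 0 := by
          rw [uInit, if_pos hx']
          exact div_neg_of_neg_of_pos (by norm_num) (Real.sqrt_pos.2 (by linarith))
        rw [hneg x hx, sgn, if_neg (by linarith)]; ring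
      constructor
      · exact (integrableOn_congr_fun e measurableSet_Iio).2 hi1.integrableOn
      · rw [setIntegral_congr_fun measurableSet_Iio e, ← integral_Iic_eq_integral_Iio, hl1]; simp
    · set a := -1 / k ^ 2 with ha
      have hk0 : k ≠ 0 := hk.ne
      have hk2 : 0 < k ^ 2 := by positivity
      have ha0 : a < 0 := div_neg_of_neg_of_pos (by norm_num) hk2
      have e : EqOn F (fun x => H1 x - 2 * (Iic a).indicator H1 x) (Iio 0) := by
        intro x hx
        have hx' : x < 0 := hx
        have hs : 0 < Real.sqrt (-x) := Real.sqrt_pos.2 (by linarith)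
        have hsq : (Real.sqrt (-x)) ^ 2 = -x := Real.sq_sqrt (by linarith)
        have key : 0 ≤ uInit x - k ↔ x ≤ a := by
          rw [uInit, if_pos hx', sub_nonneg, le_div_iff₀ hs, ha, le_div_iff₀ hk2]
          constructor
          · intro h
            nlinarith
          · intro h
            have : 1 ≤ (-k * Real.sqrt (-x)) ^ 2 := by rw [mul_pow, hsq]; nlinarith
            have h3 : 0 < -k * Real.sqrt (-x) := mul_pos (by linarith) hs
            nlinarith
        simp only [hneg x hx, sgn]
        by_cases h : x ≤ a
        · rw [if_pos (key.2 h), indicator_of_mem (by simpa using h)]; ring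
        · rw [if_neg (fun h' => h (key.1 h')), indicator_of_notMem (by simpa using h)]; ring
      have hi2 : Integrable (fun x => 2 * (Iic a).indicator H1 x) :=
        (hi1.indicator measurableSet_Iic).const_mul 2
      constructor
      · exact (integrableOn_congr_fun e measurableSet_Iio).2 (hi1.sub hi2).integrableOn
      · rw [setIntegral_congr_fun measurableSet_Iio e, ← integral_Iic_eq_integral_Iio,
          integral_sub hi1.integrableOn hi2.integrableOn, integral_const_mul,
          setIntegral_indicator measurableSet_Iic, inter_eq_self_of_subset_right
            (Iic_subset_Iic.2 ha0.le), hl1, hl1]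
        have : 1 + a * k ^ 2 = 0 := by rw [ha]; field_simp; ring
        rw [this]; simp
  have hL' : IntegrableOn F (Iic 0) := (integrableOn_Iic_iff_integrableOn_Iio).2 hL.1
  refine ⟨?_, ?_⟩
  · rw [← integrableOn_univ, ← Iic_union_Ioi (a := (0:ℝ))]
    exact hL'.union hR.1
  · rw [← intervalIntegral.integral_Iic_add_Ioi hL' hR.1, integral_Iic_eq_integral_Iio, hL.2, hR.2,
      add_zero]

/-- the time-independent function `(x,t) ↦ uInit x` is a stationary Kružkov
entropy solution of `u_t + (x u²)_x = 0` with itself as initial datum: for every `k ∈ ℝ`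
and every nonnegative smooth compactly supported test function `φ` on `ℝ × ℝ`, the
Kružkov entropy inequality (with initial term) holds. -/
theorem statement8 (k : ℝ) (φ : ℝ × ℝ → ℝ) (hφ : ContDiff ℝ (⊤ : ℕ∞) φ)
    (hφc : HasCompactSupport φ) (hφpos : ∀ p, 0 ≤ φ p) :
    0 ≤ (∫ t in Ioi (0 : ℝ), ∫ x : ℝ,
          (|uInit x - k| * fderiv ℝ φ (x, t) (0, 1)
            + sgn (uInit x - k) * (x * (uInit x) ^ 2 - x * k ^ 2)
                * fderiv ℝ φ (x, t) (1, 0)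
            - sgn (uInit x - k) * k ^ 2 * φ (x, t)))
        + ∫ x : ℝ, |uInit x - k| * φ (x, 0) := by
  have hφ1 : ContDiff ℝ 1 φ := hφ.of_le (by exact_mod_cast le_top)
  have hdiff : Differentiable ℝ φ := hφ1.differentiable (by norm_num)
  have hfc : Continuous (fderiv ℝ φ) := hφ1.continuous_fderiv (by norm_num)
  have hTc : Continuous (fun p => fderiv ℝ φ p (0, 1)) := by fun_prop
  have hTs : HasCompactSupport (fun p => fderiv ℝ φ p (0, 1)) :=
    hφc.fderiv_apply (𝕜 := ℝ) (0, 1)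
  have hdx : ∀ x t, deriv (fun y => φ (y, t)) x = fderiv ℝ φ (x, t) (1, 0) := by
    intro x t
    have h1 : HasDerivAt (fun y : ℝ => (y, t)) ((1 : ℝ), (0 : ℝ)) x :=
      (hasDerivAt_id x).prodMk (hasDerivAt_const x t)
    exact ((hdiff (x, t)).hasFDerivAt.comp_hasDerivAt x h1).deriv
  have hdt : ∀ x t, deriv (fun s => φ (x, s)) t = fderiv ℝ φ (x, t) (0, 1) := by
    intro x t
    have h1 : HasDerivAt (fun s : ℝ => (x, s)) ((0 : ℝ), (1 : ℝ)) t :=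
      (hasDerivAt_const t x).prodMk (hasDerivAt_id t)
    exact ((hdiff (x, t)).hasFDerivAt.comp_hasDerivAt t h1).deriv
  have inner : ∀ t : ℝ, (∫ x : ℝ,
          (|uInit x - k| * fderiv ℝ φ (x, t) (0, 1)
            + sgn (uInit x - k) * (x * (uInit x) ^ 2 - x * k ^ 2)
                * fderiv ℝ φ (x, t) (1, 0)
            - sgn (uInit x - k) * k ^ 2 * φ (x, t)))
      = (∫ x : ℝ, |uInit x - k| * fderiv ℝ φ (x, t) (0, 1)) + φ (0, t) := by
    intro t
    obtain ⟨hi, hv⟩ := space_part k (fun y => φ (y, t)) (by fun_prop) (slice_x hφc t)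
    simp only [hdx] at hi hv
    rw [← hv, ← integral_add (int_slice k t hTc hTs) hi]
    congr 1
    funext x
    ring
  simp_rw [inner]
  have hP : Integrable (fun p : ℝ × ℝ => |uInit p.1 - k| * fderiv ℝ φ p (0, 1))
      (volume.prod (volume.restrict (Ioi (0:ℝ)))) := by
    refine (int_prod k hTc hTs).mono_measure ?_
    exact Measure.prod_mono le_rfl Measure.restrict_le_self
  have h0i : Integrable (fun t => φ (0, t)) :=
    (by fun_prop : Continuous fun t => φ (0, t)).integrable_of_hasCompactSupport (slice_t hφc 0)
  have hA : Integrable (fun t => ∫ x : ℝ, |uInit x - k| * fderiv ℝ φ (x, t) (0, 1))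
      (volume.restrict (Ioi (0:ℝ))) := hP.swap.integral_prod_left
  rw [integral_add hA h0i.integrableOn]
  have hsw : (∫ t in Ioi (0:ℝ), ∫ x : ℝ, |uInit x - k| * fderiv ℝ φ (x, t) (0, 1))
      = - ∫ x : ℝ, |uInit x - k| * φ (x, 0) := by
    rw [← integral_integral_swap (f := fun x t => |uInit x - k| * fderiv ℝ φ (x, t) (0, 1)) hP,
      ← integral_neg]
    congr 1
    funext x
    have := (slice_t hφc x).integral_Ioi_deriv_eq (by fun_prop) 0
    simp only [hdt] at this
    rw [integral_const_mul, this]; ring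
  rw [hsw]
  have : 0 ≤ ∫ t in Ioi (0:ℝ), φ (0, t) := integral_nonneg fun t => hφpos _
  linarith
end
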